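/- arXiv:0808.3267 — 5 statements merged into one kernel-verified Lean document; each statement's English description precedes it below -/
import Mathlib

section
/- Let L be the cochain complex [L^{-2} --d^{-2}--> L^{-1} --d^{-1}--> L^0] concentrated in degrees -2, -1, 0 and let K be the cochain complex [K^{-1} --u--> K^0] concentrated in degrees -1, 0, both with entries in C. Assume Ext^0(L^0, K^{-1}) = 0 and Ext^1(L^0, K^{-1}) = 0. Then the canonical map from homotopy classes of chain maps L -> K to morphisms L -> K in the derived category D(C) is bijective; moreover, since every homotopy between chain maps L -> K is given by a morphism L^0 -> K^{-1} and Hom(L^0, K^{-1}) = Ext^0(L^0,K^{-1}) = 0, this identifies the group of actual chain maps L -> K with Hom_{D(C)}(L, K). -/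
open CategoryTheory CategoryTheory.Limits CochainComplex CochainComplex.HomComplex

universe w v u

section

variable {C : Type u} [Category.{v} C] [Abelian C]

/-- If `0 ⟶ M₁ ⟶ M₂ ⟶ M₃ ⟶ M₄` is exact and `Ext¹(X, M₁) = 0`, then any morphism `X ⟶ M₃`
whose composition with `M₃ ⟶ M₄` vanishes lifts to `M₂`. -/
lemma exists_lift_of_ext_one_eq_zero [HasExt.{w} C] {X M₁ M₂ M₃ M₄ : C}
    {f : M₁ ⟶ M₂} {g : M₂ ⟶ M₃} {h : M₃ ⟶ M₄} [Mono f] {w₁ : f ≫ g = 0} {w₂ : g ≫ h = 0}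
    (e₁ : (ShortComplex.mk f g w₁).Exact) (e₂ : (ShortComplex.mk g h w₂).Exact)
    (hX : ∀ e : Abelian.Ext X M₁ 1, e = 0) (φ : X ⟶ M₃) (hφ : φ ≫ h = 0) :
    ∃ ψ : X ⟶ M₂, ψ ≫ g = φ := by
  let S : ShortComplex C := ShortComplex.mk f (kernel.lift h g w₂)
    (by simp [← cancel_mono (kernel.ι h), w₁])
  have hS : S.ShortExact :=
    { exact := by
        rw [ShortComplex.exact_iff_exact_up_to_refinements] at e₁ ⊢
        intro A x hx
        exact e₁ x (by simpa [S] using hx =≫ kernel.ι h)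
      mono_f := by dsimp [S]; infer_instance
      epi_g := (ShortComplex.exact_iff_epi_kernel_lift _).1 e₂ }
  obtain ⟨x, hx⟩ := Abelian.Ext.covariant_sequence_exact₃ X hS
    (Abelian.Ext.mk₀ (kernel.lift h φ hφ)) (zero_add 1) (hX _)
  obtain ⟨ψ, rfl⟩ := (Abelian.Ext.mk₀_bijective _ _).2 x
  rw [Abelian.Ext.mk₀_comp_mk₀] at hx
  refine ⟨ψ, ?_⟩
  simpa [S] using (Abelian.Ext.mk₀_bijective _ _).1 hx =≫ kernel.ι h

/-- Vanishing of `Ext` groups is invariant under isomorphism in the second variable. -/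
lemma ext_eq_zero_of_iso [HasExt.{w} C] {X Y Z : C} (i : Y ≅ Z) {n : ℕ}
    (hX : ∀ e : Abelian.Ext X Y n, e = 0) (e : Abelian.Ext X Z n) : e = 0 := by
  have := hX (e.comp (Abelian.Ext.mk₀ i.inv) (add_zero n))
  have h : (e.comp (Abelian.Ext.mk₀ i.inv) (add_zero n)).comp
      (Abelian.Ext.mk₀ i.hom) (add_zero n) = e := by simp
  rw [← h, this, Abelian.Ext.zero_comp]

namespace CochainComplex

variable {L K M : CochainComplex C ℤ}

lemma _root_.HomologicalComplex.Acyclic.exact_mk (hM : M.Acyclic) (i j k : ℤ) (hij : i + 1 = j) (hjk : j + 1 = k) :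
    (ShortComplex.mk (M.d i j) (M.d j k) (M.d_comp_d i j k)).Exact :=
  (M.exactAt_iff' i j k (by simp; lia) (by simp; lia)).1 (hM j)

lemma _root_.HomologicalComplex.Acyclic.mono_d (hM : M.Acyclic) (n m : ℤ) (hnm : n + 1 = m) [M.IsStrictlyGE n] :
    Mono (M.d n m) :=
  (hM.exact_mk (n - 1) n m (by lia) hnm).mono_g
    ((M.isZero_of_isStrictlyGE n (n - 1)).eq_of_src _ _)

/-- Any morphism from a complex in degrees `≤ 0` to an acyclic complex `M` in degrees `≥ -2`
is homotopic to zero if `Ext¹(L⁰, M⁻²) = 0`. -/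
lemma nonempty_homotopy_zero_of_acyclic [HasExt.{w} C] [L.IsStrictlyLE 0]
    [M.IsStrictlyGE (-2)] (hM : M.Acyclic)
    (hLM : ∀ e : Abelian.Ext (L.X 0) (M.X (-2)) 1, e = 0) (φ : L ⟶ M) :
    Nonempty (Homotopy φ 0) := by
  have := hM.mono_d (-2) (-1) (by lia)
  obtain ⟨h, hh⟩ := exists_lift_of_ext_one_eq_zero (hM.exact_mk (-2) (-1) 0 (by lia) (by lia))
    (hM.exact_mk (-1) 0 1 (by lia) (by lia)) hLM (φ.f 0)
    (by rw [φ.comm, (L.isZero_of_isStrictlyLE 0 1).eq_of_src (φ.f 1) 0, comp_zero])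
  have hex := hM.exact_mk (-2) (-1) 0 (by lia) (by lia)
  have hk₀ : (φ.f (-1) - L.d (-1) 0 ≫ h) ≫ M.d (-1) 0 = 0 := by simp [hh]
  let k : L.X (-1) ⟶ M.X (-2) := hex.lift _ hk₀
  have hk : k ≫ M.d (-2) (-1) = φ.f (-1) - L.d (-1) 0 ≫ h := hex.lift_f _ hk₀
  have hdk : L.d (-2) (-1) ≫ k = φ.f (-2) := by
    simp [← cancel_mono (M.d (-2) (-1)), hk]
  refine ⟨(Cochain.equivHomotopy φ 0).symm
    ⟨Cochain.single h (-1) + Cochain.single k (-1), ?_⟩⟩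
  rw [δ_add, Cochain.δ_single h (-1) 0 (by lia) (-1) 0 (by lia) (by lia),
    Cochain.δ_single k (-1) 0 (by lia) (-2) (-1) (by lia) (by lia), hh, hk, hdk]
  ext p
  by_cases hp₀ : p = 0
  · subst hp₀
    simp [Cochain.single_v_eq_zero]
  by_cases hp₁ : p = -1
  · subst hp₁
    simp [Cochain.single_v_eq_zero]
  by_cases hp₂ : p = -2
  · subst hp₂
    simp [Cochain.single_v_eq_zero]
  · by_cases hp : 0 < p
    · exact (L.isZero_of_isStrictlyLE 0 p).eq_of_src _ _
    · exact (M.isZero_of_isStrictlyGE (-2) p).eq_of_tgt _ _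

/-- A cocycle of degree `-1` from a complex in degrees `≤ 0` to an acyclic complex `M` in
degrees `≥ -2` vanishes if `Hom(L⁰, M⁻²) = 0`. -/
lemma cocycle_eq_zero_of_acyclic [L.IsStrictlyLE 0] [M.IsStrictlyGE (-2)] (hM : M.Acyclic)
    (hLM : ∀ f : L.X 0 ⟶ M.X (-2), f = 0) (z : Cocycle L M (-1)) : z = 0 := by
  have := hM.mono_d (-2) (-1) (by lia)
  have hex := hM.exact_mk (-2) (-1) 0 (by lia) (by lia)
  have h₀ : z.1.v 0 (-1) (by lia) = 0 := by
    have h := Cochain.congr_v (z.δ_eq_zero 0) 0 0 (by lia)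
    rw [δ_v (-1) 0 (by lia) z.1 0 0 (by lia) (-1) 1 (by lia) (by lia), Cochain.zero_v,
      (L.isZero_of_isStrictlyLE 0 1).eq_of_src (z.1.v 1 0 _) 0, comp_zero, smul_zero,
      add_zero] at h
    rw [← hex.lift_f _ h, hLM (hex.lift _ h), zero_comp]
  have h₁ : z.1.v (-1) (-2) (by lia) = 0 := by
    have h := Cochain.congr_v (z.δ_eq_zero 0) (-1) (-1) (by lia)
    rwa [δ_v (-1) 0 (by lia) z.1 (-1) (-1) (by lia) (-2) 0 (by lia) (by lia), Cochain.zero_v,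
      h₀, comp_zero, smul_zero, add_zero, ← zero_comp (f := M.d (-2) (-1)), cancel_mono] at h
  ext p q hpq
  by_cases hp₀ : p = 0
  · subst hp₀
    obtain rfl : q = -1 := by lia
    exact h₀
  by_cases hp₁ : p = -1
  · subst hp₁
    obtain rfl : q = -2 := by lia
    exact h₁
  · by_cases hp : 0 < p
    · exact (L.isZero_of_isStrictlyLE 0 p).eq_of_src _ _
    · exact (M.isZero_of_isStrictlyGE (-2) q).eq_of_tgt _ _

lemma acyclic_mappingCone (s : K ⟶ M) [QuasiIso s] : (mappingCone s).Acyclic := by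
  rw [← HomotopyCategory.quotient_obj_mem_subcategoryAcyclic_iff_acyclic]
  refine ((HomotopyCategory.subcategoryAcyclic C).trW_iff_of_distinguished _
    (HomotopyCategory.mappingCone_triangleh_distinguished s)).1 ?_
  rw [← HomotopyCategory.quasiIso_eq_trW_subcategoryAcyclic]
  exact (HomotopyCategory.quotient_map_mem_quasiIso_iff s).2 ‹_›

/-- The lowest term of the mapping cone of a morphism to a complex in degrees `≥ m`. -/
noncomputable def mappingConeXIso (s : K ⟶ M) (n m : ℤ) (hnm : n + 1 = m)
    [M.IsStrictlyGE m] : K.X m ≅ (mappingCone s).X n where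
  hom := (mappingCone.inl s).v m n (by lia)
  inv := (mappingCone.fst s).1.v n m hnm
  inv_hom_id := by
    rw [← mappingCone.id_X s n m hnm,
      (M.isZero_of_isStrictlyGE m n).eq_of_tgt ((mappingCone.snd s).v n n (add_zero n)) 0]
    simp

/-- A morphism from a complex in degrees `≤ 0` to a complex `K` in degrees `≥ -1` which
becomes homotopic to zero after composition with a quasi-isomorphism to a complex in degrees
`≥ -1` vanishes if `Hom(L⁰, K⁻¹) = 0`. -/
lemma eq_zero_of_homotopy_comp_quasiIso [L.IsStrictlyLE 0] [K.IsStrictlyGE (-1)]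
    [M.IsStrictlyGE (-1)] (hLK : ∀ f : L.X 0 ⟶ K.X (-1), f = 0) (s : K ⟶ M) [QuasiIso s]
    (f : L ⟶ K) (h : Homotopy (f ≫ s) 0) : f = 0 := by
  have : (mappingCone s).IsStrictlyGE (-2) := isStrictlyGE_mappingCone s (-1) (-1) (-2)
  let i := mappingConeXIso s (-2) (-1) (by lia)
  obtain ⟨β, hβ⟩ := Cochain.equivHomotopy _ _ h
  let z := mappingCone.liftCocycle s (Cocycle.ofHom f) (-β) (by lia) (by
    simp only [Cochain.ofHom_zero, add_zero] at hβ
    simp [← hβ, Cochain.ofHom_comp])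
  have hz : z = 0 := cocycle_eq_zero_of_acyclic (acyclic_mappingCone s)
    (fun g => by rw [← cancel_mono i.inv, zero_comp]; exact hLK _) z
  have h' : z.1.comp (mappingCone.fst s).1 (by lia : -1 + 1 = 0) = Cochain.ofHom f :=
    mappingCone.liftCochain_fst ..
  refine Cochain.ofHom_injective ?_
  rw [← h', hz]
  simp

/-- Morphisms from a complex in degrees `≤ 0` lift, up to homotopy, along a quasi-isomorphism
`K ⟶ M` between complexes in degrees `≥ -1` if `Ext¹(L⁰, K⁻¹) = 0`. -/
lemma exists_lift_up_to_homotopy [HasExt.{w} C] [L.IsStrictlyLE 0] [K.IsStrictlyGE (-1)]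
    [M.IsStrictlyGE (-1)] (hLK : ∀ e : Abelian.Ext (L.X 0) (K.X (-1)) 1, e = 0)
    (s : K ⟶ M) [QuasiIso s] (g : L ⟶ M) :
    ∃ f : L ⟶ K, Nonempty (Homotopy (f ≫ s) g) := by
  have : (mappingCone s).IsStrictlyGE (-2) := isStrictlyGE_mappingCone s (-1) (-1) (-2)
  obtain ⟨h⟩ := nonempty_homotopy_zero_of_acyclic (acyclic_mappingCone s)
    (ext_eq_zero_of_iso (mappingConeXIso s (-2) (-1) (by lia)) hLK) (g ≫ mappingCone.inr s)
  obtain ⟨f, hf⟩ := Pretriangulated.Triangle.coyoneda_exact₂ _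
    (HomotopyCategory.mappingCone_triangleh_distinguished s)
    ((HomotopyCategory.quotient C (ComplexShape.up ℤ)).map g)
    (((HomotopyCategory.quotient _ _).map_comp _ _).symm.trans
      ((HomotopyCategory.eq_of_homotopy _ _ h).trans (Functor.map_zero _ _ _)))
  obtain ⟨f, rfl⟩ := (HomotopyCategory.quotient _ _).map_surjective f
  exact ⟨f, ⟨HomotopyCategory.homotopyOfEq _ _
    (((HomotopyCategory.quotient _ _).map_comp _ _).trans hf.symm)⟩⟩

end CochainComplex

namespace DerivedCategory

variable [HasDerivedCategory C] {L K : CochainComplex C ℤ}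

/-- If a morphism to a complex in degrees `≥ n` vanishes in the derived category, it becomes
homotopic to zero after composition with a quasi-isomorphism to a complex in degrees `≥ n`. -/
lemma exists_quasiIso_homotopy_zero (n : ℤ) [K.IsStrictlyGE n] (f : L ⟶ K)
    (hf : Q.map f = 0) :
    ∃ (M : CochainComplex C ℤ) (_ : M.IsStrictlyGE n) (s : K ⟶ M) (_ : QuasiIso s),
      Nonempty (Homotopy (f ≫ s) 0) := by
  have hf' : Qh.map ((HomotopyCategory.quotient C (ComplexShape.up ℤ)).map f) = Qh.map 0 := by
    rw [← cancel_mono ((quotientCompQhIso C).hom.app K), quotientCompQhIso_hom_naturality, hf]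
    simp
  obtain ⟨M, s, hs, fac⟩ := (MorphismProperty.map_eq_iff_postcomp Qh
    (HomotopyCategory.quasiIso C (ComplexShape.up ℤ)) _ _).1 hf'
  obtain ⟨M, rfl⟩ := HomotopyCategory.quotient_obj_surjective M
  obtain ⟨s, rfl⟩ := (HomotopyCategory.quotient _ _).map_surjective s
  have := (HomotopyCategory.quotient_map_mem_quasiIso_iff s).1 hs
  rw [HomologicalComplex.mem_quasiIso_iff] at this
  refine ⟨CochainComplex.truncGE M n, inferInstance, s ≫ CochainComplex.πTruncGE M n, ?_, ⟨?_⟩⟩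
  · rw [← CochainComplex.πTruncGE_naturality]
    have : QuasiIso (CochainComplex.truncGEMap s n) := by
      rw [CochainComplex.quasiIso_truncGEMap_iff]
      infer_instance
    infer_instance
  · refine HomotopyCategory.homotopyOfEq _ _ ?_
    rw [← Category.assoc, Functor.map_comp, Functor.map_comp, fac]
    simp

/-- Chain maps from a complex in degrees `≤ 0` to a complex in degrees `≥ -1` are the same as
morphisms in the derived category if `Ext⁰(L⁰, K⁻¹)` and `Ext¹(L⁰, K⁻¹)` vanish. -/
lemma Q_map_bijective_of_ext_eq_zero [HasExt.{w} C] [L.IsStrictlyLE 0] [K.IsStrictlyGE (-1)]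
    (h0 : ∀ e : Abelian.Ext (L.X 0) (K.X (-1)) 0, e = 0)
    (h1 : ∀ e : Abelian.Ext (L.X 0) (K.X (-1)) 1, e = 0) :
    Function.Bijective (fun f : L ⟶ K => Q.map f) := by
  have hLK (f : L.X 0 ⟶ K.X (-1)) : f = 0 :=
    (Abelian.Ext.mk₀_bijective _ _).1 (by rw [h0 (Abelian.Ext.mk₀ f), Abelian.Ext.mk₀_zero])
  constructor
  · intro f g hfg
    obtain ⟨M, _, s, _, ⟨h⟩⟩ := exists_quasiIso_homotopy_zero (-1) (f - g)
      (by rw [Functor.map_sub, sub_eq_zero]; exact hfg)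
    exact sub_eq_zero.1 (eq_zero_of_homotopy_comp_quasiIso hLK s _ h)
  · intro φ
    obtain ⟨M, _, g, s, hs, rfl⟩ := left_fac_of_isStrictlyGE φ (-1)
    have := (isIso_Q_map_iff_quasiIso C s).1 hs
    obtain ⟨f, ⟨h⟩⟩ := exists_lift_up_to_homotopy h1 s g
    refine ⟨f, ?_⟩
    rw [IsIso.eq_comp_inv, ← Functor.map_comp]
    exact Q_map_eq_of_homotopy C h

/-- If the localization functor `Q` is bijective on morphisms `L ⟶ K`, so is `Qh`. -/
lemma Qh_map_bijective_of_Q_map_bijective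
    (hQ : Function.Bijective (fun f : L ⟶ K => Q.map f)) :
    Function.Bijective
      (fun f : ((HomotopyCategory.quotient C (ComplexShape.up ℤ)).obj L ⟶
        (HomotopyCategory.quotient C (ComplexShape.up ℤ)).obj K) => Qh.map f) := by
  let e : (Qh.obj ((HomotopyCategory.quotient C (ComplexShape.up ℤ)).obj L) ⟶
      Qh.obj ((HomotopyCategory.quotient C (ComplexShape.up ℤ)).obj K)) ≃
      (Q.obj L ⟶ Q.obj K) :=
    Iso.homCongr ((quotientCompQhIso C).app L) ((quotientCompQhIso C).app K)
  have he (f : L ⟶ K) :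
      e (Qh.map ((HomotopyCategory.quotient C (ComplexShape.up ℤ)).map f)) = Q.map f := by
    simp [e, Iso.homCongr]
  constructor
  · intro f g hfg
    obtain ⟨f, rfl⟩ := (HomotopyCategory.quotient _ _).map_surjective f
    obtain ⟨g, rfl⟩ := (HomotopyCategory.quotient _ _).map_surjective g
    rw [hQ.1 ((he f).symm.trans ((congrArg e hfg).trans (he g)))]
  · intro φ
    obtain ⟨f, hf⟩ := hQ.2 (e φ)
    exact ⟨(HomotopyCategory.quotient _ _).map f, e.injective ((he f).trans hf)⟩

end DerivedCategory

end

/-- **Lemma 3.1 (1).** Let `L = [L⁻² → L⁻¹ → L⁰]` be a cochain complex concentrated in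
degrees `-2, -1, 0` and `K = [K⁻¹ → K⁰]` a cochain complex concentrated in degrees `-1, 0`
in an abelian category `C`. If `Ext⁰(L⁰, K⁻¹) = 0` and `Ext¹(L⁰, K⁻¹) = 0`, then both the
canonical map from chain maps `L ⟶ K` to `Hom_{D(C)}(L, K)` and the canonical map from
homotopy classes of chain maps to `Hom_{D(C)}(L, K)` are bijective. -/
theorem stmt0 {C : Type*} [Category C] [Abelian C] [EnoughInjectives C]
    [HasDerivedCategory C] [CategoryTheory.HasExt C]
    (L K : CochainComplex C ℤ)
    (hL : ∀ n : ℤ, n ≠ -2 → n ≠ -1 → n ≠ 0 → IsZero (L.X n))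
    (hK : ∀ n : ℤ, n ≠ -1 → n ≠ 0 → IsZero (K.X n))
    (h0 : ∀ e : Abelian.Ext (L.X 0) (K.X (-1)) 0, e = 0)
    (h1 : ∀ e : Abelian.Ext (L.X 0) (K.X (-1)) 1, e = 0) :
    Function.Bijective (fun f : L ⟶ K => DerivedCategory.Q.map f) ∧
    Function.Bijective
      (fun f : ((HomotopyCategory.quotient C (ComplexShape.up ℤ)).obj L ⟶
          (HomotopyCategory.quotient C (ComplexShape.up ℤ)).obj K) =>
        DerivedCategory.Qh.map f) := by
  have : L.IsStrictlyLE 0 := by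
    rw [isStrictlyLE_iff]
    exact fun i hi => hL i (by lia) (by lia) (by lia)
  have : K.IsStrictlyGE (-1) := by
    rw [isStrictlyGE_iff]
    exact fun i hi => hK i (by lia) (by lia)
  have hQ := DerivedCategory.Q_map_bijective_of_ext_eq_zero h0 h1
  exact ⟨hQ, DerivedCategory.Qh_map_bijective_of_Q_map_bijective hQ⟩
end

section
/- Let L be the cochain complex [L^{-2} --d^{-2}--> L^{-1} --d^{-1}--> L^0] concentrated in degrees -2, -1, 0 and let K be the cochain complex [K^{-1} --u--> K^0] concentrated in degrees -1, 0, both with entries in C. Assume Ext^i(L^0, K^{-1}) = 0 for i = 0, 1 and 2. Assume moreover that the map d_1^{-1,1} : Ext^1(L^0, K^0) \oplus Ext^1(L^{-1}, K^{-1}) -> Ext^1(L^{-1}, K^0) \oplus Ext^1(L^{-2}, K^{-1}) sending a pair (\alpha, \beta) to the pair (pullback of \alpha along d^{-1}: L^{-1} -> L^0 minus pushforward of \beta along u: K^{-1} -> K^0, pullback of \beta along d^{-2}: L^{-2} -> L^{-1}) has trivial kernel. Then the canonical map from homotopy classes of chain maps L -> K[1] to Hom_{D(C)}(L, K[1]) is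 surjective; in other words, every morphism L -> K[1] in the derived category D(C) is represented by an actual chain map of complexes L -> K[1]. -/
open CategoryTheory CategoryTheory.Limits CategoryTheory.Abelian
open CategoryTheory.Pretriangulated

/-- Let `F` be a triangulated functor, `L` an iterated extension of `E`, `B`, `A` and `M` an
extension of `P` by `Q`. If `F` is full on `E ⟶ P` and `B ⟶ Q`, faithful on `E ⟶ Q⟦1⟧`, the
morphisms `F A ⟶ F P`, `(F A)⟦1⟧ ⟶ F P` and `F E ⟶ F Q` vanish, and so do the pairs
`(F A ⟶ F Q, F B ⟶ F P)` compatible with the connecting morphisms, then every morphism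
`F L ⟶ F M` comes from a morphism `L ⟶ M`. -/
theorem exists_map_eq_of_distinguished {𝒦 𝒟 : Type*} [Category 𝒦] [Category 𝒟]
    [HasZeroObject 𝒦] [HasShift 𝒦 ℤ] [Preadditive 𝒦]
    [∀ n : ℤ, (shiftFunctor 𝒦 n).Additive] [Pretriangulated 𝒦]
    [HasZeroObject 𝒟] [HasShift 𝒟 ℤ] [Preadditive 𝒟]
    [∀ n : ℤ, (shiftFunctor 𝒟 n).Additive] [Pretriangulated 𝒟]
    (F : 𝒦 ⥤ 𝒟) [F.CommShift ℤ] [F.IsTriangulated] [F.Additive]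
    {A L₁ B L E Q M P : 𝒦}
    {a : A ⟶ L₁} {q : L₁ ⟶ B} {δ₁ : B ⟶ A⟦(1 : ℤ)⟧} (h₁ : Triangle.mk a q δ₁ ∈ distTriang 𝒦)
    {i : L₁ ⟶ L} {p : L ⟶ E} {δ₂ : E ⟶ L₁⟦(1 : ℤ)⟧} (h₂ : Triangle.mk i p δ₂ ∈ distTriang 𝒦)
    {w : Q ⟶ M} {t : M ⟶ P} {δ₃ : P ⟶ Q⟦(1 : ℤ)⟧} (h₃ : Triangle.mk w t δ₃ ∈ distTriang 𝒦)
    (hAP : ∀ x : F.obj A ⟶ F.obj P, x = 0)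
    (hAP' : ∀ x : (F.obj A)⟦(1 : ℤ)⟧ ⟶ F.obj P, x = 0)
    (hEQ : ∀ x : F.obj E ⟶ F.obj Q, x = 0)
    (hEP : Function.Surjective (F.map : (E ⟶ P) → _))
    (hBQ : Function.Surjective (F.map : (B ⟶ Q) → _))
    (hEQ' : Function.Injective (F.map : (E ⟶ Q⟦(1 : ℤ)⟧) → _))
    (hker : ∀ (α : F.obj A ⟶ F.obj Q) (β : F.obj B ⟶ F.obj P),
      (F.map δ₁ ≫ (F.commShiftIso (1 : ℤ)).hom.app A) ≫ α⟦(1 : ℤ)⟧' =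
        β ≫ F.map δ₃ ≫ (F.commShiftIso (1 : ℤ)).hom.app Q →
      (F.map (δ₂ ≫ q⟦(1 : ℤ)⟧') ≫ (F.commShiftIso (1 : ℤ)).hom.app B) ≫ β⟦(1 : ℤ)⟧' = 0 →
      α = 0 ∧ β = 0) :
    Function.Surjective (F.map : (L ⟶ M) → _) := by
  intro f
  have H₁ : Triangle.mk (F.map a) (F.map q) (F.map δ₁ ≫ (F.commShiftIso (1 : ℤ)).hom.app A) ∈
    distTriang 𝒟 := F.map_distinguished _ h₁
  have H₂ : Triangle.mk (F.map i) (F.map p) (F.map δ₂ ≫ (F.commShiftIso (1 : ℤ)).hom.app L₁) ∈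
    distTriang 𝒟 := F.map_distinguished _ h₂
  have H₃ : Triangle.mk (F.map w) (F.map t) (F.map δ₃ ≫ (F.commShiftIso (1 : ℤ)).hom.app Q) ∈
    distTriang 𝒟 := F.map_distinguished _ h₃
  obtain ⟨β, hβ⟩ : ∃ β : F.obj B ⟶ F.obj P, F.map i ≫ f ≫ F.map t = F.map q ≫ β :=
    Triangle.yoneda_exact₂ _ H₁ (F.map i ≫ f ≫ F.map t) (hAP _)
  obtain ⟨α, hα, hαβ⟩ : ∃ α : F.obj A ⟶ F.obj Q, F.map a ≫ F.map i ≫ f = α ≫ F.map w ∧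
      (F.map δ₁ ≫ (F.commShiftIso (1 : ℤ)).hom.app A) ≫ α⟦(1 : ℤ)⟧' =
        β ≫ F.map δ₃ ≫ (F.commShiftIso (1 : ℤ)).hom.app Q :=
    complete_distinguished_triangle_morphism₁ _ _ H₁ H₃ (F.map i ≫ f) β
      (hβ.symm.trans (Category.assoc _ _ _).symm)
  have hi : (F.map δ₂ ≫ (F.commShiftIso (1 : ℤ)).hom.app L₁) ≫ (F.map i)⟦(1 : ℤ)⟧' = 0 :=
    comp_distTriang_mor_zero₃₁ _ H₂
  obtain ⟨rfl, rfl⟩ := hker α β hαβ (by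
    have := congr((F.map δ₂ ≫ (F.commShiftIso (1 : ℤ)).hom.app L₁) ≫ $hβ⟦(1 : ℤ)⟧')
    simp only [Functor.map_comp] at this
    rw [← Category.assoc, hi, zero_comp] at this
    simpa using this.symm)
  have hα' : F.map a ≫ F.map i ≫ f = 0 := by simpa using hα
  rw [comp_zero] at hβ
  obtain ⟨c, hc⟩ : ∃ c : F.obj E ⟶ F.obj P, f ≫ F.map t = F.map p ≫ c :=
    Triangle.yoneda_exact₂ _ H₂ _ hβ
  obtain ⟨b', hb', hb'c⟩ : ∃ b' : F.obj L₁ ⟶ F.obj Q, F.map i ≫ f = b' ≫ F.map w ∧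
      (F.map δ₂ ≫ (F.commShiftIso (1 : ℤ)).hom.app L₁) ≫ b'⟦(1 : ℤ)⟧' =
        c ≫ F.map δ₃ ≫ (F.commShiftIso (1 : ℤ)).hom.app Q :=
    complete_distinguished_triangle_morphism₁ _ _ H₂ H₃ f c hc.symm
  have hab : F.map a ≫ b' = 0 := by
    obtain ⟨g, hg⟩ : ∃ g : (F.obj A)⟦(1 : ℤ)⟧ ⟶ F.obj P, (F.map a ≫ b')⟦(1 : ℤ)⟧' =
        g ≫ F.map δ₃ ≫ (F.commShiftIso (1 : ℤ)).hom.app Q :=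
      Triangle.coyoneda_exact₁ _ H₃ ((F.map a ≫ b')⟦(1 : ℤ)⟧') (by
      change (F.map a ≫ b')⟦(1 : ℤ)⟧' ≫ (F.map w)⟦(1 : ℤ)⟧' = 0
      rw [← Functor.map_comp, Category.assoc, ← hb', hα', Functor.map_zero])
    rw [hAP' g, zero_comp] at hg
    exact (shiftFunctor 𝒟 (1 : ℤ)).map_injective (by simpa using hg)
  obtain ⟨b, hb⟩ : ∃ b : F.obj B ⟶ F.obj Q, b' = F.map q ≫ b :=
    Triangle.yoneda_exact₂ _ H₁ b' hab
  obtain ⟨b, rfl⟩ := hBQ b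
  obtain ⟨c, rfl⟩ := hEP c
  obtain ⟨φ, hφ, -⟩ : ∃ φ : L ⟶ M, i ≫ φ = (q ≫ b) ≫ w ∧ _ :=
    complete_distinguished_triangle_morphism₂ _ _ h₂ h₃ (q ≫ b) c (by
    apply hEQ'
    rw [← cancel_mono ((F.commShiftIso (1 : ℤ)).hom.app Q)]
    change F.map (δ₂ ≫ (q ≫ b)⟦(1 : ℤ)⟧') ≫ _ = F.map (c ≫ δ₃) ≫ _
    rw [hb] at hb'c
    simpa using hb'c)
  obtain ⟨h, hh⟩ : ∃ h : F.obj E ⟶ F.obj M, f - F.map φ = F.map p ≫ h :=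
    Triangle.yoneda_exact₂ _ H₂ _ (by
      change F.map i ≫ (f - F.map φ) = 0
      rw [Preadditive.comp_sub, hb', ← F.map_comp, hφ, hb]
      simp)
  obtain ⟨e, he⟩ := hEP (h ≫ F.map t)
  have ht : F.map t ≫ (F.map δ₃ ≫ (F.commShiftIso (1 : ℤ)).hom.app Q) = 0 :=
    comp_distTriang_mor_zero₂₃ _ H₃
  obtain ⟨ψ, hψ⟩ : ∃ ψ : E ⟶ M, e = ψ ≫ t := Triangle.coyoneda_exact₃ _ h₃ e (by
    apply hEQ'
    rw [← cancel_mono ((F.commShiftIso (1 : ℤ)).hom.app Q)]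
    change F.map (e ≫ δ₃) ≫ _ = F.map 0 ≫ _
    rw [F.map_comp, he, Category.assoc, Category.assoc, ht]
    simp)
  obtain ⟨x, hx⟩ : ∃ x : F.obj E ⟶ F.obj Q, h - F.map ψ = x ≫ F.map w :=
    Triangle.coyoneda_exact₂ _ H₃ _ (by
      change (h - F.map ψ) ≫ F.map t = 0
      rw [Preadditive.sub_comp, ← he, hψ, F.map_comp, sub_self])
  rw [hEQ x, zero_comp, sub_eq_zero] at hx
  exact ⟨φ + p ≫ ψ, by rw [F.map_add, F.map_comp, ← hx, ← hh]; abel⟩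

/-- A pair of composable morphisms of complexes which in each degree is a trivially split short
exact sequence extends to a distinguished triangle, whose third morphism is the differential of
the middle complex between the two kinds of degrees. -/
theorem exists_distinguished_of_isIso_or_isIso {C : Type*} [Category C] [Abelian C]
    {X₁ X₂ X₃ : CochainComplex C ℤ} (f : X₁ ⟶ X₂) (g : X₂ ⟶ X₃)
    (h : ∀ n, (IsZero (X₁.X n) ∧ IsIso (g.f n)) ∨ (IsIso (f.f n) ∧ IsZero (X₃.X n))) :
    ∃ δ : X₃ ⟶ X₁⟦(1 : ℤ)⟧,
      (HomotopyCategory.quotient C (ComplexShape.up ℤ)).mapTriangle.obj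
        (Triangle.mk f g δ) ∈ distTriang _ ∧
      ∀ (n : ℤ) (x : X₃.X n ⟶ X₁.X (n + 1)), IsIso (g.f n) → IsIso (f.f (n + 1)) →
        g.f n ≫ x ≫ f.f (n + 1) = X₂.d n (n + 1) → δ.f n = x := by
  have zero : f ≫ g = 0 := by
    ext n
    obtain ⟨h₁, -⟩ | ⟨-, h₃⟩ := h n
    · exact h₁.eq_of_src _ _
    · exact h₃.eq_of_tgt _ _
  let S := ShortComplex.mk f g zero
  have hσ (n : ℤ) : Nonempty (S.map (HomologicalComplex.eval C _ n)).Splitting := by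
    obtain ⟨h₁, h₂⟩ | ⟨h₁, h₂⟩ := h n
    · exact ⟨.ofIsZeroOfIsIso _ h₁ h₂⟩
    · exact ⟨.ofIsIsoOfIsZero _ h₁ h₂⟩
  let σ n := (hσ n).some
  refine ⟨CochainComplex.homOfDegreewiseSplit S σ,
    (HomotopyCategory.distinguished_iff_iso_trianglehOfDegreewiseSplit _).2
      ⟨S, σ, ⟨Iso.refl _⟩⟩, fun n x _ _ hx => ?_⟩
  let s : X₃.X n ⟶ X₂.X n := (σ n).s
  let r : X₂.X (n + 1) ⟶ X₁.X (n + 1) := (σ (n + 1)).r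
  have hs : s ≫ g.f n = 𝟙 _ := (σ n).s_g
  have hr : f.f (n + 1) ≫ r = 𝟙 _ := (σ (n + 1)).f_r
  rw [CochainComplex.homOfDegreewiseSplit_f]
  change s ≫ X₂.d n (n + 1) ≫ r = x
  rw [← hx]
  simp only [Category.assoc]
  rw [reassoc_of% hs, hr, Category.comp_id]

/-- The object in degree `n` of the complex `X[-n]` is `X`. -/
noncomputable def singleFunctorObjXSelfIso {C : Type*} [Category C] [Abelian C] (n : ℤ) (X : C) :
    ((CochainComplex.singleFunctor C n).obj X).X n ≅ X :=
  HomologicalComplex.singleObjXSelf (ComplexShape.up ℤ) n X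

theorem isZero_singleFunctor_obj_X {C : Type*} [Category C] [Abelian C] (n : ℤ) (X : C)
    (k : ℤ) (hk : k ≠ n) : IsZero (((CochainComplex.singleFunctor C n).obj X).X k) :=
  HomologicalComplex.isZero_single_obj_X _ _ _ _ hk

theorem singleFunctor_map_comp_shiftIso_inv_app_f {C : Type*} [Category C] [Abelian C]
    {X Y : C} (f : X ⟶ Y) (n : ℤ) :
    ((CochainComplex.singleFunctor C n).map f ≫
      ((CochainComplex.singleFunctors C).shiftIso 1 n (n + 1) (add_comm _ _)).inv.app Y).f n =
      (singleFunctorObjXSelfIso n X).hom ≫ f ≫ (singleFunctorObjXSelfIso (n + 1) Y).inv := by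
  have h₁ : ((CochainComplex.singleFunctor C n).map f).f n =
      (singleFunctorObjXSelfIso n X).hom ≫ f ≫ (singleFunctorObjXSelfIso n Y).inv :=
    HomologicalComplex.single_map_f_self _ _ _
  have h₂ : (singleFunctorObjXSelfIso n Y).inv ≫
      (((CochainComplex.singleFunctors C).shiftIso 1 n (n + 1) (add_comm _ _)).inv.app Y).f n =
      (singleFunctorObjXSelfIso (n + 1) Y).inv :=
    eqToHom_trans (HomologicalComplex.single_obj_X_self (ComplexShape.up ℤ) n Y).symm
      ((HomologicalComplex.single_obj_X_self (ComplexShape.up ℤ) n Y).trans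
        (HomologicalComplex.single_obj_X_self (ComplexShape.up ℤ) (n + 1) Y).symm)
  rw [HomologicalComplex.comp_f, h₁, Category.assoc, Category.assoc, h₂]
  rfl

/-- The distinguished triangle `Y[-m] ⟶ E ⟶ X[-n] ⟶ Y[-m][1]` attached to a complex `E`
concentrated in degrees `n` and `m = n + 1`. -/
theorem exists_distinguished_of_two_term {C : Type*} [Category C] [Abelian C]
    (E : CochainComplex C ℤ) {n m : ℤ} (h : n + 1 = m)
    (hE : ∀ k, k ≠ n → k ≠ m → IsZero (E.X k)) {X Y : C} (f : X ⟶ Y)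
    (eX : E.X n ≅ X) (eY : E.X m ≅ Y) (hf : E.d n m = eX.hom ≫ f ≫ eY.inv) :
    ∃ (w : (CochainComplex.singleFunctor C m).obj Y ⟶ E)
      (t : E ⟶ (CochainComplex.singleFunctor C n).obj X),
      t.f n = eX.hom ≫ (singleFunctorObjXSelfIso n X).inv ∧
      (HomotopyCategory.quotient C (ComplexShape.up ℤ)).mapTriangle.obj
        (Triangle.mk w t ((CochainComplex.singleFunctor C n).map f ≫
          ((CochainComplex.singleFunctors C).shiftIso 1 n m (by lia)).inv.app Y)) ∈
        distTriang _ := by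
  subst h
  let w : (CochainComplex.singleFunctor C (n + 1)).obj Y ⟶ E :=
    HomologicalComplex.mkHomFromSingle eY.inv (fun k hk => by
      have : n + 1 + 1 = k := hk
      exact (hE k (by lia) (by lia)).eq_of_tgt _ _)
  let t : E ⟶ (CochainComplex.singleFunctor C n).obj X :=
    HomologicalComplex.mkHomToSingle eX.hom (fun k hk => by
      have : k + 1 = n := hk
      exact (hE k (by lia) (by lia)).eq_of_src _ _)
  have ht : t.f n = (eX ≪≫ (singleFunctorObjXSelfIso n X).symm).hom :=
    HomologicalComplex.mkHomToSingle_f _ _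
  have hw : w.f (n + 1) = (singleFunctorObjXSelfIso (n + 1) Y ≪≫ eY.symm).hom :=
    HomologicalComplex.mkHomFromSingle_f _ _
  have htn : IsIso (t.f n) := by rw [ht]; infer_instance
  have hwn : IsIso (w.f (n + 1)) := by rw [hw]; infer_instance
  obtain ⟨δ, hδ, hδ'⟩ := exists_distinguished_of_isIso_or_isIso w t (by
    intro k
    by_cases hk : k = n
    · subst hk
      exact Or.inl ⟨isZero_singleFunctor_obj_X _ _ _ (by lia), htn⟩
    · refine Or.inr ⟨?_, isZero_singleFunctor_obj_X _ _ _ hk⟩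
      by_cases hk' : k = n + 1
      · subst hk'
        exact hwn
      · exact (isZero_singleFunctor_obj_X _ _ _ hk').isIso (hE k hk hk') _)
  refine ⟨w, t, ht, ?_⟩
  convert hδ using 3
  refine (HomologicalComplex.from_single_hom_ext ?_).symm
  refine (hδ' n _ htn hwn ?_).trans (singleFunctor_map_comp_shiftIso_inv_app_f f n).symm
  rw [hf, ht, hw]
  simp

/-- A complex concentrated in three consecutive degrees is an iterated extension of the single
complexes on its terms, with connecting morphisms given by its differentials. -/
theorem exists_distinguished_of_three_term {C : Type*} [Category C] [Abelian C]
    (L : CochainComplex C ℤ) {n₀ n₁ n₂ : ℤ} (h₀₁ : n₀ + 1 = n₁) (h₁₂ : n₁ + 1 = n₂)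
    (hL : ∀ k, k ≠ n₀ → k ≠ n₁ → k ≠ n₂ → IsZero (L.X k)) :
    ∃ (L₁ : CochainComplex C ℤ) (a : (CochainComplex.singleFunctor C n₂).obj (L.X n₂) ⟶ L₁)
      (q : L₁ ⟶ (CochainComplex.singleFunctor C n₁).obj (L.X n₁))
      (i : L₁ ⟶ L) (p : L ⟶ (CochainComplex.singleFunctor C n₀).obj (L.X n₀))
      (δ : (CochainComplex.singleFunctor C n₀).obj (L.X n₀) ⟶ L₁⟦(1 : ℤ)⟧),
      (HomotopyCategory.quotient C (ComplexShape.up ℤ)).mapTriangle.obj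
        (Triangle.mk a q ((CochainComplex.singleFunctor C n₁).map (L.d n₁ n₂) ≫
          ((CochainComplex.singleFunctors C).shiftIso 1 n₁ n₂ (by lia)).inv.app _)) ∈
        distTriang _ ∧
      (HomotopyCategory.quotient C (ComplexShape.up ℤ)).mapTriangle.obj
        (Triangle.mk i p δ) ∈ distTriang _ ∧
      δ ≫ q⟦(1 : ℤ)⟧' = (CochainComplex.singleFunctor C n₀).map (L.d n₀ n₁) ≫
          ((CochainComplex.singleFunctors C).shiftIso 1 n₀ n₁ (by lia)).inv.app _ := by
  subst h₀₁ h₁₂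
  have hrel : (ComplexShape.up ℤ).Rel (n₀ + 1) (n₀ + 1 + 1) := rfl
  have hne : n₀ + 1 ≠ n₀ + 1 + 1 := by lia
  let L₁ := HomologicalComplex.double (L.d (n₀ + 1) (n₀ + 1 + 1)) hrel
  let e₁ : L₁.X (n₀ + 1) ≅ L.X (n₀ + 1) := HomologicalComplex.doubleXIso₀ _ hrel
  let e₂ : L₁.X (n₀ + 1 + 1) ≅ L.X (n₀ + 1 + 1) := HomologicalComplex.doubleXIso₁ _ hrel hne
  have zL₁ (k : ℤ) (hk : k ≠ n₀ + 1) (hk' : k ≠ n₀ + 1 + 1) : IsZero (L₁.X k) :=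
    HomologicalComplex.isZero_double_X _ _ _ hk hk'
  obtain ⟨a, q, hq, h₁⟩ := exists_distinguished_of_two_term L₁ rfl zL₁
    (L.d (n₀ + 1) (n₀ + 1 + 1)) e₁ e₂ (HomologicalComplex.double_d _ hrel hne)
  let i : L₁ ⟶ L := HomologicalComplex.mkHomFromDouble hrel hne (𝟙 _) (𝟙 _) (by simp) (by
    intro k hk
    have : n₀ + 1 + 1 + 1 = k := hk
    exact (hL k (by lia) (by lia) (by lia)).eq_of_tgt _ _)
  have hi₁ : i.f (n₀ + 1) = e₁.hom :=
    (HomologicalComplex.mkHomFromDouble_f₀ _ _ _ _ _ _).trans (Category.comp_id _)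
  have hi₂ : i.f (n₀ + 1 + 1) = e₂.hom :=
    (HomologicalComplex.mkHomFromDouble_f₁ _ _ _ _ _ _).trans (Category.comp_id _)
  let p : L ⟶ (CochainComplex.singleFunctor C n₀).obj (L.X n₀) :=
    HomologicalComplex.mkHomToSingle (𝟙 _) (fun k hk => by
      have : k + 1 = n₀ := hk
      exact (hL k (by lia) (by lia) (by lia)).eq_of_src _ _)
  have hp : p.f n₀ = (singleFunctorObjXSelfIso n₀ (L.X n₀)).inv :=
    (HomologicalComplex.mkHomToSingle_f _ _).trans (Category.id_comp _)
  have hi₁' : IsIso (i.f (n₀ + 1)) := by rw [hi₁]; infer_instance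
  have hp' : IsIso (p.f n₀) := by rw [hp]; infer_instance
  obtain ⟨δ, hδ, hδ'⟩ := exists_distinguished_of_isIso_or_isIso i p (by
    intro k
    by_cases hk : k = n₀
    · subst hk
      exact Or.inl ⟨zL₁ _ (by lia) (by lia), hp'⟩
    · refine Or.inr ⟨?_, isZero_singleFunctor_obj_X _ _ _ hk⟩
      by_cases hk₁ : k = n₀ + 1
      · subst hk₁
        exact hi₁'
      · by_cases hk₂ : k = n₀ + 1 + 1
        · subst hk₂
          rw [hi₂]
          infer_instance
        · exact (zL₁ _ hk₁ hk₂).isIso (hL k hk hk₁ hk₂) _)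
  refine ⟨L₁, a, q, i, p, δ, h₁, hδ, HomologicalComplex.from_single_hom_ext ?_⟩
  refine Eq.trans ?_ (singleFunctor_map_comp_shiftIso_inv_app_f _ n₀).symm
  rw [HomologicalComplex.comp_f, hδ' n₀ ((singleFunctorObjXSelfIso n₀ (L.X n₀)).hom ≫
    L.d n₀ (n₀ + 1) ≫ e₁.inv) hp' hi₁' (by rw [hi₁, hp]; simp)]
  change _ ≫ q.f (n₀ + 1) = _
  rw [hq]
  simp

theorem Qh_map_singleFunctor_map_comp_shiftIso_inv_app {C : Type*} [Category C] [Abelian C]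
    [HasDerivedCategory C] {X Y : C} (f : X ⟶ Y) (n m : ℤ) (h : 1 + n = m) :
    DerivedCategory.Qh.map ((HomotopyCategory.quotient C (ComplexShape.up ℤ)).map
        ((CochainComplex.singleFunctor C n).map f ≫
          ((CochainComplex.singleFunctors C).shiftIso 1 n m h).inv.app Y) ≫
        ((HomotopyCategory.quotient C (ComplexShape.up ℤ)).commShiftIso (1 : ℤ)).hom.app _) ≫
      (DerivedCategory.Qh.commShiftIso (1 : ℤ)).hom.app _ =
    (DerivedCategory.singleFunctor C n).map f ≫
      ((DerivedCategory.singleFunctors C).shiftIso 1 n m h).inv.app Y := by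
  have h₁ : ((HomotopyCategory.singleFunctors C).shiftIso 1 n m h).inv.app Y =
      (HomotopyCategory.quotient C (ComplexShape.up ℤ)).map
        (((CochainComplex.singleFunctors C).shiftIso 1 n m h).inv.app Y) ≫
      ((HomotopyCategory.quotient C (ComplexShape.up ℤ)).commShiftIso (1 : ℤ)).hom.app _ :=
    SingleFunctors.postcomp_shiftIso_inv_app _ _ _ _ _ _ _
  have h₂ : ((DerivedCategory.singleFunctors C).shiftIso 1 n m h).inv.app Y =
      DerivedCategory.Qh.map (((HomotopyCategory.singleFunctors C).shiftIso 1 n m h).inv.app Y) ≫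
      (DerivedCategory.Qh.commShiftIso (1 : ℤ)).hom.app _ :=
    SingleFunctors.postcomp_shiftIso_inv_app _ _ _ _ _ _ _
  rw [h₂, h₁]
  rw [Functor.map_comp (HomotopyCategory.quotient C _), Category.assoc, Functor.map_comp,
    Category.assoc]
  rfl

/-- A morphism from `X` in degree `m` to `Y` in degree `n = m - 1` is, up to the shift isomorphisms,
the shift of a morphism `X ⟶ Y⟦1⟧` in degree `k = m + 1`. -/
theorem SingleFunctors.exists_shift_map_eq {C 𝒟 : Type*} [Category C] [Category 𝒟]
    [HasShift 𝒟 ℤ] (S : SingleFunctors C 𝒟 ℤ) {X Y : C} {n m k : ℤ} (h : 1 + n = m)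
    (h' : 1 + m = k) (β : (S.functor m).obj X ⟶ (S.functor n).obj Y) :
    ∃ β' : (S.functor k).obj X ⟶ ((S.functor k).obj Y)⟦(1 : ℤ)⟧,
      β = (S.shiftIso 1 m k h').inv.app X ≫ β'⟦(1 : ℤ)⟧' ≫
        ((S.shiftIso 1 m k h').hom.app Y)⟦(1 : ℤ)⟧' ≫ (S.shiftIso 1 n m h).hom.app Y := by
  obtain ⟨β', hβ'⟩ := (shiftFunctor 𝒟 (1 : ℤ)).map_surjective
    (X := (S.functor k).obj X) (Y := ((S.functor k).obj Y)⟦(1 : ℤ)⟧)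
    ((S.shiftIso 1 m k h').hom.app X ≫ β ≫ (S.shiftIso 1 n m h).inv.app Y ≫
      ((S.shiftIso 1 m k h').inv.app Y)⟦(1 : ℤ)⟧')
  refine ⟨β', ?_⟩
  rw [hβ']
  simp [← Functor.map_comp_assoc]

theorem SingleFunctors.shiftIso_inv_app_comp_eq_iff {C 𝒟 : Type*} [Category C] [Category 𝒟]
    [HasShift 𝒟 ℤ] (S : SingleFunctors C 𝒟 ℤ) {A B P Q : C} {n m k : ℤ} (h : 1 + n = m)
    (h' : 1 + m = k) (d : B ⟶ A) (u : P ⟶ Q) (α : (S.functor k).obj A ⟶ (S.functor m).obj Q)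
    (β : (S.functor k).obj B ⟶ ((S.functor k).obj P)⟦(1 : ℤ)⟧) :
    ((S.functor m).map d ≫ (S.shiftIso 1 m k h').inv.app A) ≫ α⟦(1 : ℤ)⟧' =
        ((S.shiftIso 1 m k h').inv.app B ≫ β⟦(1 : ℤ)⟧' ≫
          ((S.shiftIso 1 m k h').hom.app P)⟦(1 : ℤ)⟧' ≫ (S.shiftIso 1 n m h).hom.app P) ≫
        (S.functor n).map u ≫ (S.shiftIso 1 n m h).inv.app Q ↔
      (S.functor k).map d ≫ α ≫ (S.shiftIso 1 m k h').inv.app Q =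
        β ≫ ((S.functor k).map u)⟦(1 : ℤ)⟧' := by
  have e₁ : (S.functor m).map d ≫ (S.shiftIso 1 m k h').inv.app A =
      (S.shiftIso 1 m k h').inv.app B ≫ ((S.functor k).map d)⟦(1 : ℤ)⟧' :=
    (S.shiftIso 1 m k h').inv.naturality d
  have e₂ : (S.shiftIso 1 n m h).hom.app P ≫ (S.functor n).map u =
      ((S.functor m).map u)⟦(1 : ℤ)⟧' ≫ (S.shiftIso 1 n m h).hom.app Q :=
    ((S.shiftIso 1 n m h).hom.naturality u).symm
  have e₃ : (S.shiftIso 1 m k h').hom.app P ≫ (S.functor m).map u =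
      ((S.functor k).map u)⟦(1 : ℤ)⟧' ≫ (S.shiftIso 1 m k h').hom.app Q :=
    ((S.shiftIso 1 m k h').hom.naturality u).symm
  have e₄ : ((S.shiftIso 1 m k h').inv.app B ≫ β⟦(1 : ℤ)⟧' ≫
          ((S.shiftIso 1 m k h').hom.app P)⟦(1 : ℤ)⟧' ≫ (S.shiftIso 1 n m h).hom.app P) ≫
        (S.functor n).map u ≫ (S.shiftIso 1 n m h).inv.app Q =
      (S.shiftIso 1 m k h').inv.app B ≫
        (β ≫ ((S.functor k).map u)⟦(1 : ℤ)⟧' ≫ (S.shiftIso 1 m k h').hom.app Q)⟦(1 : ℤ)⟧' := by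
    rw [← e₃]
    simp only [Category.assoc, reassoc_of% e₂, Functor.map_comp]
    simp
  rw [e₁, e₄, Category.assoc, cancel_epi, ← Functor.map_comp,
    (shiftFunctor 𝒟 (1 : ℤ)).map_injective.eq_iff,
    ← cancel_mono ((S.shiftIso 1 m k h').inv.app Q)]
  simp

theorem SingleFunctors.shiftIso_inv_app_comp_eq_zero_iff {C 𝒟 : Type*} [Category C] [Category 𝒟]
    [Preadditive 𝒟] [HasShift 𝒟 ℤ] [∀ n : ℤ, (shiftFunctor 𝒟 n).Additive]
    (S : SingleFunctors C 𝒟 ℤ) {B E P : C} {n m k : ℤ} (h : 1 + n = m)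
    (h' : 1 + m = k) (d : E ⟶ B)
    (β : (S.functor k).obj B ⟶ ((S.functor k).obj P)⟦(1 : ℤ)⟧) :
    ((S.functor n).map d ≫ (S.shiftIso 1 n m h).inv.app B) ≫
        ((S.shiftIso 1 m k h').inv.app B ≫ β⟦(1 : ℤ)⟧' ≫
          ((S.shiftIso 1 m k h').hom.app P)⟦(1 : ℤ)⟧' ≫
            (S.shiftIso 1 n m h).hom.app P)⟦(1 : ℤ)⟧' = 0 ↔
      (S.functor k).map d ≫ β = 0 := by
  have e₁ : (S.functor n).map d ≫ (S.shiftIso 1 n m h).inv.app B =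
      (S.shiftIso 1 n m h).inv.app E ≫ ((S.functor m).map d)⟦(1 : ℤ)⟧' :=
    (S.shiftIso 1 n m h).inv.naturality d
  have e₂ : (S.functor m).map d ≫ (S.shiftIso 1 m k h').inv.app B =
      (S.shiftIso 1 m k h').inv.app E ≫ ((S.functor k).map d)⟦(1 : ℤ)⟧' :=
    (S.shiftIso 1 m k h').inv.naturality d
  rw [e₁, Category.assoc, ← Functor.map_comp, reassoc_of% e₂, ← Functor.map_comp_assoc,
    Preadditive.IsIso.comp_left_eq_zero, Functor.map_eq_zero_iff,
    Preadditive.IsIso.comp_left_eq_zero, Preadditive.IsIso.comp_right_eq_zero,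
    Functor.map_eq_zero_iff]

theorem Qh_map_bijective_singleFunctor {C : Type*} [Category C] [Abelian C]
    [HasDerivedCategory C] (n : ℤ) (X Y : C) :
    Function.Bijective (DerivedCategory.Qh.map :
      ((HomotopyCategory.singleFunctor C n).obj X ⟶
        (HomotopyCategory.singleFunctor C n).obj Y) → _) := by
  have hfull : Function.Surjective ((HomotopyCategory.singleFunctor C n).map : (X ⟶ Y) → _) := by
    intro x
    obtain ⟨y, hy⟩ := (HomotopyCategory.quotient C (ComplexShape.up ℤ)).map_surjective
      (X := (CochainComplex.singleFunctor C n).obj X)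
      (Y := (CochainComplex.singleFunctor C n).obj Y) x
    obtain ⟨z, rfl⟩ := (CochainComplex.singleFunctor C n).map_surjective y
    exact ⟨z, hy⟩
  refine ⟨fun x y hxy => ?_, fun x => ?_⟩
  · obtain ⟨x, rfl⟩ := hfull x
    obtain ⟨y, rfl⟩ := hfull y
    exact congr_arg _ ((DerivedCategory.singleFunctor C n).map_injective hxy)
  · obtain ⟨y, hy⟩ := (DerivedCategory.singleFunctor C n).map_surjective x
    exact ⟨(HomotopyCategory.singleFunctor C n).map y, hy⟩

theorem Qh_map_injective_singleFunctor_shift {C : Type*} [Category C] [Abelian C]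
    [HasDerivedCategory C] {n m : ℤ} (h : 1 + n = m) (X Y : C) :
    Function.Injective (DerivedCategory.Qh.map :
      ((HomotopyCategory.singleFunctor C n).obj X ⟶
        ((HomotopyCategory.singleFunctor C m).obj Y)⟦(1 : ℤ)⟧) → _) := by
  intro x y hxy
  let σ := ((HomotopyCategory.singleFunctors C).shiftIso 1 n m h).hom.app Y
  refine (cancel_mono σ).1 ((Qh_map_bijective_singleFunctor n X Y).1 ?_)
  exact (Functor.map_comp _ _ _).trans ((congr($hxy ≫ _)).trans (Functor.map_comp _ _ _).symm)

/-- Surjectivity of `K(C) ⟶ D(C)` on morphisms from a complex concentrated in degrees `-2, -1, 0`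
to a complex concentrated in degrees `-2, -1`, under vanishing conditions on morphisms in `D(C)`
between the terms. -/
theorem Qh_map_surjective_of_three_term_of_two_term {C : Type*} [Category C] [Abelian C]
    [HasDerivedCategory C] (L M : CochainComplex C ℤ)
    (hL : ∀ n : ℤ, n ≠ -2 → n ≠ -1 → n ≠ 0 → IsZero (L.X n))
    (hM : ∀ n : ℤ, n ≠ -2 → n ≠ -1 → IsZero (M.X n))
    (h₁ : ∀ x : (DerivedCategory.singleFunctor C 0).obj (L.X 0) ⟶
      ((DerivedCategory.singleFunctor C 0).obj (M.X (-2)))⟦(1 : ℤ)⟧, x = 0)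
    (h₂ : ∀ x : (DerivedCategory.singleFunctor C 0).obj (L.X 0) ⟶
      ((DerivedCategory.singleFunctor C 0).obj (M.X (-2)))⟦(2 : ℤ)⟧, x = 0)
    (hker : ∀ (α : (DerivedCategory.singleFunctor C 0).obj (L.X 0) ⟶
        ((DerivedCategory.singleFunctor C 0).obj (M.X (-1)))⟦(1 : ℤ)⟧)
      (β : (DerivedCategory.singleFunctor C 0).obj (L.X (-1)) ⟶
        ((DerivedCategory.singleFunctor C 0).obj (M.X (-2)))⟦(1 : ℤ)⟧),
      (DerivedCategory.singleFunctor C 0).map (L.d (-1) 0) ≫ α =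
        β ≫ ((DerivedCategory.singleFunctor C 0).map (M.d (-2) (-1)))⟦(1 : ℤ)⟧' →
      (DerivedCategory.singleFunctor C 0).map (L.d (-2) (-1)) ≫ β = 0 → α = 0 ∧ β = 0) :
    Function.Surjective (DerivedCategory.Qh.map :
      ((HomotopyCategory.quotient C (ComplexShape.up ℤ)).obj L ⟶
        (HomotopyCategory.quotient C (ComplexShape.up ℤ)).obj M) → _) := by
  obtain ⟨L₁, a, q, i, p, δ, T₁, T₂, hδ⟩ := exists_distinguished_of_three_term L
    (n₀ := -2) (n₁ := -1) (n₂ := 0) rfl rfl hL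
  obtain ⟨w, t, -, T₃⟩ := exists_distinguished_of_two_term M (n := -2) (m := -1) rfl hM
    (M.d (-2) (-1)) (Iso.refl _) (Iso.refl _) (by simp)
  let π := HomotopyCategory.quotient C (ComplexShape.up ℤ)
  have hδ' : π.map ((CochainComplex.singleFunctor C (-2)).map (L.d (-2) (-1)) ≫
      ((CochainComplex.singleFunctors C).shiftIso 1 (-2) (-1) rfl).inv.app _) ≫
        (π.commShiftIso (1 : ℤ)).hom.app _ =
      (π.map δ ≫ (π.commShiftIso (1 : ℤ)).hom.app _) ≫ (π.map q)⟦(1 : ℤ)⟧' := by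
    rw [← hδ, π.map_comp, Category.assoc, Category.assoc, π.commShiftIso_hom_naturality]
  let S := DerivedCategory.singleFunctors C
  let s := S.shiftIso 1 (-1) 0 rfl
  let s' := S.shiftIso 1 (-2) (-1) rfl
  refine exists_map_eq_of_distinguished DerivedCategory.Qh T₁ T₂ T₃ ?_ ?_ ?_
    (Qh_map_bijective_singleFunctor _ _ _).2 (Qh_map_bijective_singleFunctor _ _ _).2
    (Qh_map_injective_singleFunctor_shift rfl _ _) ?_
  · intro (x : (S.functor 0).obj (L.X 0) ⟶ (S.functor (-2)).obj (M.X (-2)))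
    exact (cancel_mono ((S.shiftIso 2 (-2) 0 rfl).inv.app (M.X (-2)))).1
      ((h₂ _).trans zero_comp.symm)
  · intro (x : ((S.functor 0).obj (L.X 0))⟦(1 : ℤ)⟧ ⟶ (S.functor (-2)).obj (M.X (-2)))
    obtain ⟨y, hy⟩ := (shiftFunctor (DerivedCategory C) (1 : ℤ)).map_surjective
      (X := (S.functor 0).obj (L.X 0)) (Y := ((S.functor 0).obj (M.X (-2)))⟦(1 : ℤ)⟧)
      (x ≫ s'.inv.app (M.X (-2)) ≫ (s.inv.app (M.X (-2)))⟦(1 : ℤ)⟧')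
    rw [h₁ y, Functor.map_zero] at hy
    exact (cancel_mono (s'.inv.app (M.X (-2)) ≫ (s.inv.app (M.X (-2)))⟦(1 : ℤ)⟧')).1
      (hy.symm.trans zero_comp.symm)
  · intro (x : (S.functor (-2)).obj (L.X (-2)) ⟶ (S.functor (-1)).obj (M.X (-1)))
    exact DerivedCategory.TStructure.t.zero x (-2) (-1)
  · intro (α : (S.functor 0).obj (L.X 0) ⟶ (S.functor (-1)).obj (M.X (-1)))
      (β : (S.functor (-1)).obj (L.X (-1)) ⟶ (S.functor (-2)).obj (M.X (-2))) H₁ H₂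
    obtain ⟨β', hβ⟩ := SingleFunctors.exists_shift_map_eq S (n := -2) (m := -1) (k := 0) rfl rfl β
    have hβ₀ (h : β' = 0) : β = 0 := by simp [hβ, h]
    subst hβ
    have e₁ := Qh_map_singleFunctor_map_comp_shiftIso_inv_app (L.d (-1) 0) (-1) 0 rfl
    have e₂ := Qh_map_singleFunctor_map_comp_shiftIso_inv_app (L.d (-2) (-1)) (-2) (-1) rfl
    have e₃ := Qh_map_singleFunctor_map_comp_shiftIso_inv_app (M.d (-2) (-1)) (-2) (-1) rfl
    have hαβ := hker (α ≫ s.inv.app _) β'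
      ((SingleFunctors.shiftIso_inv_app_comp_eq_iff S (n := -2) (m := -1) (k := 0) rfl rfl
        (L.d (-1) 0) (M.d (-2) (-1)) α β').1
        (congr($e₁.symm ≫ _).trans (H₁.trans congr(_ ≫ $e₃))))
      ((SingleFunctors.shiftIso_inv_app_comp_eq_zero_iff S (n := -2) (m := -1) (k := 0) rfl rfl
        (L.d (-2) (-1)) β').1
        (congr($(e₂.symm.trans congr(DerivedCategory.Qh.map $hδ' ≫ _)) ≫ _).trans H₂))
    exact ⟨(cancel_mono (s.inv.app _)).1 (hαβ.1.trans zero_comp.symm), hβ₀ hαβ.2⟩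

theorem singleFunctor_eq_zero_of_ext_eq_zero {C : Type*} [Category C] [Abelian C]
    [HasDerivedCategory C] [HasExt C] {A B E P Q : C} (d : B ⟶ A) (d' : E ⟶ B) (u : P ⟶ Q)
    (hker : ∀ (α : Ext A Q 1) (β : Ext B P 1),
      (Ext.mk₀ d).comp α (zero_add 1) = β.comp (Ext.mk₀ u) (add_zero 1) →
      (Ext.mk₀ d').comp β (zero_add 1) = 0 → α = 0 ∧ β = 0)
    (α : (DerivedCategory.singleFunctor C 0).obj A ⟶
      ((DerivedCategory.singleFunctor C 0).obj Q)⟦(1 : ℤ)⟧)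
    (β : (DerivedCategory.singleFunctor C 0).obj B ⟶
      ((DerivedCategory.singleFunctor C 0).obj P)⟦(1 : ℤ)⟧)
    (h : (DerivedCategory.singleFunctor C 0).map d ≫ α =
      β ≫ ((DerivedCategory.singleFunctor C 0).map u)⟦(1 : ℤ)⟧')
    (h' : (DerivedCategory.singleFunctor C 0).map d' ≫ β = 0) : α = 0 ∧ β = 0 := by
  obtain ⟨α, rfl⟩ := (Ext.homAddEquiv (X := A) (Y := Q) (n := 1)).surjective α
  obtain ⟨β, rfl⟩ := (Ext.homAddEquiv (X := B) (Y := P) (n := 1)).surjective β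
  obtain ⟨rfl, rfl⟩ := hker α β
    (Ext.ext (by
      rw [Ext.comp_hom, Ext.comp_hom, Ext.mk₀_hom, Ext.mk₀_hom, ShiftedHom.mk₀_comp,
        ShiftedHom.comp_mk₀]
      exact h))
    (Ext.ext (by
      rw [Ext.comp_hom, Ext.mk₀_hom, ShiftedHom.mk₀_comp, Ext.zero_hom]
      exact h'))
  exact ⟨map_zero _, map_zero _⟩

/-- **Lemma 3.1 (2).** Let `L = [L⁻² → L⁻¹ → L⁰]` be a cochain complex concentrated in
degrees `-2, -1, 0` and `K = [K⁻¹ → K⁰]` a cochain complex concentrated in degrees `-1, 0`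
in an abelian category `C`. Assume `Extⁱ(L⁰, K⁻¹) = 0` for `i = 0, 1, 2`, and that the map
`d₁⁻¹¹ : Ext¹(L⁰, K⁰) ⊕ Ext¹(L⁻¹, K⁻¹) → Ext¹(L⁻¹, K⁰) ⊕ Ext¹(L⁻², K⁻¹)`,
`(α, β) ↦ (d⁻¹ ^* α - u_* β, d⁻² ^* β)`, has trivial kernel. Then the canonical map from
homotopy classes of chain maps `L ⟶ K[1]` to `Hom_{D(C)}(L, K[1])` is surjective; in other
words, every morphism `L ⟶ K[1]` in the derived category is represented by an actual chain
map of complexes. -/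
theorem stmt1 {C : Type*} [Category C] [Abelian C] [EnoughInjectives C]
    [HasDerivedCategory C] [CategoryTheory.HasExt C]
    (L K : CochainComplex C ℤ)
    (hL : ∀ n : ℤ, n ≠ -2 → n ≠ -1 → n ≠ 0 → IsZero (L.X n))
    (hK : ∀ n : ℤ, n ≠ -1 → n ≠ 0 → IsZero (K.X n))
    (h0 : ∀ e : Ext (L.X 0) (K.X (-1)) 0, e = 0)
    (h1 : ∀ e : Ext (L.X 0) (K.X (-1)) 1, e = 0)
    (h2 : ∀ e : Ext (L.X 0) (K.X (-1)) 2, e = 0)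
    (hker : ∀ (α : Ext (L.X 0) (K.X 0) 1) (β : Ext (L.X (-1)) (K.X (-1)) 1),
      (Ext.mk₀ (L.d (-1) 0)).comp α (zero_add 1) -
          β.comp (Ext.mk₀ (K.d (-1) 0)) (add_zero 1) = 0 →
      (Ext.mk₀ (L.d (-2) (-1))).comp β (zero_add 1) = 0 →
      α = 0 ∧ β = 0) :
    Function.Surjective
      (fun f : ((HomotopyCategory.quotient C (ComplexShape.up ℤ)).obj L ⟶
          (HomotopyCategory.quotient C (ComplexShape.up ℤ)).obj (K⟦(1 : ℤ)⟧)) =>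
        DerivedCategory.Qh.map f) ∧
    Function.Surjective (fun f : L ⟶ K⟦(1 : ℤ)⟧ => DerivedCategory.Q.map f) := by
  have d_eq : (K⟦(1 : ℤ)⟧).d (-2) (-1) = -K.d (-1) 0 := by simp
  have surj := Qh_map_surjective_of_three_term_of_two_term L (K⟦(1 : ℤ)⟧) hL
    (fun n _ _ => hK (n + 1) (by lia) (by lia))
    (fun x => Ext.homAddEquiv.symm.injective ((h1 _).trans (map_zero _).symm))
    (fun x => Ext.homAddEquiv.symm.injective ((h2 _).trans (map_zero _).symm))
    (singleFunctor_eq_zero_of_ext_eq_zero _ _ _ (by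
      intro (α : Ext (L.X 0) (K.X 0) 1) (β : Ext (L.X (-1)) (K.X (-1)) 1) H₁ H₂
      rw [d_eq] at H₁
      replace H₁ : (Ext.mk₀ (L.d (-1) 0)).comp α (zero_add 1) =
        β.comp (Ext.mk₀ (-K.d (-1) 0)) (add_zero 1) := H₁
      obtain ⟨hα, hβ⟩ := hker (-α) β (by simp [H₁, Ext.mk₀_neg]) H₂
      exact ⟨neg_eq_zero.1 hα, hβ⟩))
  refine ⟨surj, fun g => ?_⟩
  obtain ⟨f, rfl⟩ := surj g
  obtain ⟨f, rfl⟩ := (HomotopyCategory.quotient C (ComplexShape.up ℤ)).map_surjective f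
  exact ⟨f, rfl⟩
end

section
/- Let K = [K^{-1} --d--> K^0] and K' = [K'^{-1} --u'--> K'^0] be cochain complexes concentrated in degrees -1 and 0 with entries in C. Assume Ext^0(K^0, K'^{-1}) = 0 and Ext^1(K^0, K'^{-1}) = 0. Then the canonical map from the group of chain maps K -> K' (pairs of morphisms f^0: K^0 -> K'^0, f^{-1}: K^{-1} -> K'^{-1} with f^0 \circ d = u' \circ f^{-1}) to Hom_{D(C)}(K, K') is bijective. -/
open CategoryTheory CategoryTheory.Limits CategoryTheory.Abelian

open CochainComplex CochainComplex.HomComplex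

section

universe v u

variable {C : Type u} [Category.{v} C] [Abelian C]

/-- The mapping cone of a quasi-isomorphism is acyclic. -/
lemma CochainComplex.acyclic_mappingCone_of_quasiIso {L K : CochainComplex C ℤ} (s : L ⟶ K)
    [QuasiIso s] : (mappingCone s).Acyclic := by
  rw [← HomotopyCategory.quotient_obj_mem_subcategoryAcyclic_iff_acyclic]
  have hs : (HomotopyCategory.subcategoryAcyclic C).trW
      ((HomotopyCategory.quotient C (ComplexShape.up ℤ)).map s) := by
    rw [← HomotopyCategory.quasiIso_eq_trW_subcategoryAcyclic,
      HomotopyCategory.quotient_map_mem_quasiIso_iff]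
    exact inferInstanceAs (QuasiIso s)
  exact (ObjectProperty.trW_iff_of_distinguished _ _
    (HomotopyCategory.mappingCone_triangleh_distinguished s)).1 hs

/-- If a morphism of complexes `K ⟶ K'` with `K` strictly `≤ n` becomes zero in the derived
category, it becomes null-homotopic after precomposition with a quasi-isomorphism from a complex
that is strictly `≤ n`. -/
lemma DerivedCategory.exists_homotopy_zero_of_Q_map_eq_zero [HasDerivedCategory C]
    {K K' : CochainComplex C ℤ} (n : ℤ) [K.IsStrictlyLE n] (f : K ⟶ K')
    (hf : DerivedCategory.Q.map f = 0) :
    ∃ (L : CochainComplex C ℤ) (_ : L.IsStrictlyLE n) (s : L ⟶ K) (_ : QuasiIso s),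
      Nonempty (Homotopy (s ≫ f) 0) := by
  have hf' : Qh.map ((HomotopyCategory.quotient _ _).map f) =
      Qh.map ((HomotopyCategory.quotient _ _).map (0 : K ⟶ K')) := by
    rw [← cancel_mono ((quotientCompQhIso C).hom.app K'), quotientCompQhIso_hom_naturality,
      quotientCompQhIso_hom_naturality, hf, Functor.map_zero]
  rw [MorphismProperty.map_eq_iff_precomp Qh
    (HomotopyCategory.quasiIso C (ComplexShape.up ℤ))] at hf'
  obtain ⟨L, s, hs, eq⟩ := hf'
  obtain ⟨L, rfl⟩ := HomotopyCategory.quotient_obj_surjective L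
  obtain ⟨s, rfl⟩ := (HomotopyCategory.quotient _ _).map_surjective s
  rw [HomotopyCategory.quotient_map_mem_quasiIso_iff] at hs
  have : QuasiIso s := hs
  rw [← Functor.map_comp, ← Functor.map_comp, comp_zero] at eq
  have h := HomotopyCategory.homotopyOfEq _ _ eq
  have : QuasiIso (truncLEMap s n) := by
    rw [quasiIso_truncLEMap_iff]
    infer_instance
  refine ⟨CochainComplex.truncLE L n, inferInstance, truncLEMap s n ≫ K.ιTruncLE n, inferInstance,
    ⟨?_⟩⟩
  rw [ιTruncLE_naturality, Category.assoc]
  exact (h.compLeft (CochainComplex.ιTruncLE L n)).trans (Homotopy.ofEq comp_zero)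

/-- A morphism from the left term of a short exact sequence extends to the middle term when
`Ext¹` from the right term vanishes. -/
lemma CategoryTheory.ShortComplex.ShortExact.exists_extension_of_ext_one_eq_zero [HasExt C]
    {S : ShortComplex C} (hS : S.ShortExact) {Y : C} (h : ∀ e : Ext S.X₃ Y 1, e = 0)
    (a : S.X₁ ⟶ Y) : ∃ b : S.X₂ ⟶ Y, S.f ≫ b = a := by
  obtain ⟨x, hx⟩ := Ext.contravariant_sequence_exact₁ hS Y (Ext.mk₀ a) (add_zero 1) (h _)
  obtain ⟨b, rfl⟩ := (Ext.mk₀_bijective _ _).2 x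
  rw [Ext.mk₀_comp_mk₀] at hx
  exact ⟨b, (Ext.mk₀_bijective _ _).1 hx⟩

namespace CochainComplex.mappingCone

variable {L K : CochainComplex C ℤ} (s : L ⟶ K)

lemma exact_sc'_of_quasiIso [QuasiIso s] (i j k : ℤ) (hij : i + 1 = j) (hjk : j + 1 = k) :
    ((mappingCone s).sc' i j k).Exact := by
  rw [← HomologicalComplex.exactAt_iff' _ i j k (by simp; lia) (by simp; lia)]
  exact acyclic_mappingCone_of_quasiIso s j

lemma epi_d_of_quasiIso [QuasiIso s] [L.IsStrictlyLE 0] [K.IsStrictlyLE 0] :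
    Epi ((mappingCone s).d (-1) 0) := by
  refine (exact_sc'_of_quasiIso s (-1) 0 1 rfl rfl).epi_f ?_
  apply IsZero.eq_of_tgt
  exact (isZero_X_iff s 1).2
    ⟨L.isZero_of_isStrictlyLE 0 _ (by lia), K.isZero_of_isStrictlyLE 0 _ (by lia)⟩

lemma mono_d_of_quasiIso [QuasiIso s] [L.IsStrictlyGE (-1)] [K.IsStrictlyGE (-1)] :
    Mono ((mappingCone s).d (-2) (-1)) := by
  refine (exact_sc'_of_quasiIso s (-3) (-2) (-1) rfl rfl).mono_g ?_
  apply IsZero.eq_of_src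
  exact (isZero_X_iff s (-3)).2
    ⟨L.isZero_of_isStrictlyGE (-1) _ (by lia), K.isZero_of_isStrictlyGE (-1) _ (by lia)⟩

/-- If `L` vanishes in degree `1`, the mapping cone of `s : L ⟶ K` agrees with `K` in degree
`0`. -/
noncomputable def XZeroIso [L.IsStrictlyLE 0] : (mappingCone s).X 0 ≅ K.X 0 where
  hom := (snd s).v 0 0 (add_zero 0)
  inv := (inr s).f 0
  hom_inv_id := by
    rw [← id_X s 0 1 rfl, (L.isZero_of_isStrictlyLE 0 1 (by lia)).eq_of_tgt
      ((fst s).1.v 0 1 rfl) 0, zero_comp, zero_add]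

end CochainComplex.mappingCone

open CochainComplex.mappingCone

variable {K K' : CochainComplex C ℤ}

/-- When `Hom (K⁰, K'⁻¹) = 0`, a morphism of complexes from `K` in degrees `-1, 0` to `K'` in
degrees `≥ -1` is zero as soon as its image in the derived category is. -/
lemma eq_zero_of_Q_map_eq_zero [HasDerivedCategory C] [K.IsStrictlyLE 0] [K.IsStrictlyGE (-1)]
    [K'.IsStrictlyGE (-1)] (h0 : ∀ e : K.X 0 ⟶ K'.X (-1), e = 0) (f : K ⟶ K')
    (hf : DerivedCategory.Q.map f = 0) : f = 0 := by
  obtain ⟨L, _, s, _, ⟨h⟩⟩ := DerivedCategory.exists_homotopy_zero_of_Q_map_eq_zero 0 f hf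
  have := epi_d_of_quasiIso s
  have comm₁ : s.f (-1) ≫ f.f (-1) = L.d (-1) 0 ≫ h.hom 0 (-1) := by
    have := h.comm (-1)
    rw [dNext_eq _ (show (ComplexShape.up ℤ).Rel (-1) 0 by simp),
      prevD_eq _ (show (ComplexShape.up ℤ).Rel (-2) (-1) by simp),
      (K'.isZero_of_isStrictlyGE (-1) (-2) (by lia)).eq_of_tgt (h.hom (-1) (-2)) 0] at this
    simpa using this
  have comm₀ : s.f 0 ≫ f.f 0 = h.hom 0 (-1) ≫ K'.d (-1) 0 := by
    have := h.comm 0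
    rw [dNext_eq _ (show (ComplexShape.up ℤ).Rel 0 1 by simp),
      prevD_eq _ (show (ComplexShape.up ℤ).Rel (-1) 0 by simp),
      (L.isZero_of_isStrictlyLE 0 1 (by lia)).eq_of_tgt (L.d 0 1) 0] at this
    simpa using this
  have hb : (mappingCone s).d (-2) (-1) ≫
      ((snd s).v (-1) (-1) (add_zero _) ≫ f.f (-1) +
        (fst s).1.v (-1) 0 rfl ≫ h.hom 0 (-1)) = 0 := by
    rw [Preadditive.comp_add, d_snd_v_assoc s (-2) (-1) rfl, d_fst_v_assoc s (-2) (-1) 0 rfl rfl,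
      (K.isZero_of_isStrictlyGE (-1) (-2) (by lia)).eq_of_src (K.d (-2) (-1)) 0]
    simp [comm₁]
  have hS := exact_sc'_of_quasiIso s (-2) (-1) 0 rfl rfl
  have : Epi ((mappingCone s).sc' (-2) (-1) 0).g := epi_d_of_quasiIso s
  obtain ⟨e, he⟩ : ∃ e : (mappingCone s).X 0 ⟶ K'.X (-1),
      (mappingCone s).d (-1) 0 ≫ e = (snd s).v (-1) (-1) (add_zero _) ≫ f.f (-1) +
        (fst s).1.v (-1) 0 rfl ≫ h.hom 0 (-1) := ⟨_, hS.g_desc _ hb⟩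
  have he0 : e = 0 := by
    rw [← cancel_epi (XZeroIso s).inv, comp_zero]
    exact h0 _
  rw [he0, comp_zero] at he
  have hf₁ : f.f (-1) = 0 := by
    simpa using ((inr s).f (-1) ≫= he).symm
  have hh : h.hom 0 (-1) = 0 := by
    simpa using ((inl s).v 0 (-1) rfl ≫= he).symm
  have hf₀ : f.f 0 = 0 := by
    have : (snd s).v 0 0 (add_zero 0) ≫ f.f 0 = 0 := by
      rw [← cancel_epi ((mappingCone s).d (-1) 0), d_snd_v_assoc s (-1) 0 rfl]
      simp [comm₀, hh, ← f.comm, hf₁]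
    simpa using (inr s).f 0 ≫= this
  ext i
  by_cases hi : 0 < i
  · exact (K.isZero_of_isStrictlyLE 0 i hi).eq_of_src _ _
  by_cases hi' : i < -1
  · exact (K.isZero_of_isStrictlyGE (-1) i hi').eq_of_src _ _
  obtain rfl | rfl : i = -1 ∨ i = 0 := by lia
  · simpa using hf₁
  · simpa using hf₀

/-- Morphisms in degrees `-1, 0` that form a commutative square extend to a morphism of complexes
when the source is strictly `≥ -1` and the target strictly `≤ 0`. -/
lemma exists_hom_of_comm [K.IsStrictlyGE (-1)] [K'.IsStrictlyLE 0]
    (g₁ : K.X (-1) ⟶ K'.X (-1)) (g₀ : K.X 0 ⟶ K'.X 0)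
    (comm : g₁ ≫ K'.d (-1) 0 = K.d (-1) 0 ≫ g₀) :
    ∃ g : K ⟶ K', g.f (-1) = g₁ ∧ g.f 0 = g₀ := by
  refine ⟨{ f := Function.update (Function.update (fun _ ↦ 0) (-1) g₁) 0 g₀
            comm' := ?_ }, by simp, by simp⟩
  rintro i j rfl
  by_cases hi : 0 ≤ i
  · exact (K'.isZero_of_isStrictlyLE 0 (i + 1) (by lia)).eq_of_tgt _ _
  by_cases hi' : i < -1
  · exact (K.isZero_of_isStrictlyGE (-1) i hi').eq_of_src _ _
  obtain rfl : i = -1 := by lia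
  simpa using comm

/-- When `Ext¹ (K⁰, K'⁻¹) = 0`, every morphism in the derived category between complexes
concentrated in degrees `-1, 0` is induced by a morphism of complexes. -/
lemma exists_Q_map_eq [HasDerivedCategory C] [HasExt C] [K.IsStrictlyLE 0] [K.IsStrictlyGE (-1)]
    [K'.IsStrictlyLE 0] [K'.IsStrictlyGE (-1)] (h1 : ∀ e : Ext (K.X 0) (K'.X (-1)) 1, e = 0)
    (φ : DerivedCategory.Q.obj K ⟶ DerivedCategory.Q.obj K') :
    ∃ g : K ⟶ K', DerivedCategory.Q.map g = φ := by
  obtain ⟨L, _, _, s, hs, f, rfl⟩ :=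
    DerivedCategory.right_fac_of_isStrictlyLE_of_isStrictlyGE (-1) 0 φ
  have : QuasiIso s := (DerivedCategory.isIso_Q_map_iff_quasiIso _ s).1 hs
  have hS := exact_sc'_of_quasiIso s (-2) (-1) 0 rfl rfl
  have : Epi ((mappingCone s).sc' (-2) (-1) 0).g := epi_d_of_quasiIso s
  have : Mono ((mappingCone s).sc' (-2) (-1) 0).f := mono_d_of_quasiIso s
  have h1' (e : Ext ((mappingCone s).X 0) (K'.X (-1)) 1) : e = 0 := by
    have := h1 ((Ext.mk₀ (XZeroIso s).inv).comp e (zero_add 1))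
    simpa using congr_arg (fun x ↦ (Ext.mk₀ (XZeroIso s).hom).comp x (zero_add 1)) this
  obtain ⟨b, hb⟩ : ∃ b : (mappingCone s).X (-1) ⟶ K'.X (-1),
      (mappingCone s).d (-2) (-1) ≫ b = (fst s).1.v (-2) (-1) rfl ≫ f.f (-1) :=
    (ShortComplex.ShortExact.mk hS).exists_extension_of_ext_one_eq_zero h1' _
  have hc : (mappingCone s).d (-2) (-1) ≫
      (b ≫ K'.d (-1) 0 + (fst s).1.v (-1) 0 rfl ≫ f.f 0) = 0 := by
    rw [Preadditive.comp_add, reassoc_of% hb, d_fst_v_assoc s (-2) (-1) 0 rfl rfl]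
    simp
  obtain ⟨e, he⟩ : ∃ e : (mappingCone s).X 0 ⟶ K'.X 0,
      (mappingCone s).d (-1) 0 ≫ e = b ≫ K'.d (-1) 0 + (fst s).1.v (-1) 0 rfl ≫ f.f 0 :=
    ⟨_, hS.g_desc _ hc⟩
  obtain ⟨g, hg₁, hg₀⟩ := exists_hom_of_comm ((inr s).f (-1) ≫ b) ((inr s).f 0 ≫ e) (by
    rw [← inr_f_d_assoc, he]
    simp)
  have comm₁ : s.f (-1) ≫ g.f (-1) = L.d (-1) 0 ≫ (inl s).v 0 (-1) rfl ≫ b + f.f (-1) := by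
    have := (inl s).v (-1) (-2) rfl ≫= hb
    rw [inl_v_d_assoc s (-1) (-2) 0 rfl rfl, inl_v_fst_v_assoc, Preadditive.sub_comp,
      sub_eq_iff_eq_add, add_comm] at this
    simpa [hg₁] using this
  have comm₀ : s.f 0 ≫ g.f 0 = ((inl s).v 0 (-1) rfl ≫ b) ≫ K'.d (-1) 0 + f.f 0 := by
    have := (inl s).v 0 (-1) rfl ≫= he
    rw [inl_v_d_assoc s 0 (-1) 1 rfl rfl,
      (L.isZero_of_isStrictlyLE 0 1 (by lia)).eq_of_tgt (L.d 0 1) 0] at this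
    simpa [hg₀] using this
  have ho : Homotopy (s ≫ g) f :=
    (Cochain.equivHomotopy _ _).symm ⟨Cochain.single ((inl s).v 0 (-1) rfl ≫ b) (-1), by
      rw [Cochain.δ_single _ (-1) 0 rfl (-1) 0 rfl rfl]
      ext i
      by_cases hi : 0 < i
      · exact (L.isZero_of_isStrictlyLE 0 i hi).eq_of_src _ _
      by_cases hi' : i < -1
      · exact (L.isZero_of_isStrictlyGE (-1) i hi').eq_of_src _ _
      obtain rfl | rfl : i = -1 ∨ i = 0 := by lia
      · simpa [Cochain.single_v_eq_zero] using comm₁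
      · simpa [Cochain.single_v_eq_zero] using comm₀⟩
  exact ⟨g, by rw [← DerivedCategory.Q_map_eq_of_homotopy _ ho, Functor.map_comp,
    IsIso.inv_hom_id_assoc]⟩

end

/-- **Lemma 3.1 (1), case `L⁻² = 0`.** Let `K = [K⁻¹ → K⁰]` and `K' = [K'⁻¹ → K'⁰]` be
cochain complexes concentrated in degrees `-1, 0` in an abelian category `C`. If
`Ext⁰(K⁰, K'⁻¹) = 0` and `Ext¹(K⁰, K'⁻¹) = 0`, then the canonical map from the group of
chain maps `K ⟶ K'` to `Hom_{D(C)}(K, K')` is bijective. -/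
theorem stmt2 {C : Type*} [Category C] [Abelian C] [EnoughInjectives C]
    [HasDerivedCategory C] [CategoryTheory.HasExt C]
    (K K' : CochainComplex C ℤ)
    (hK : ∀ n : ℤ, n ≠ -1 → n ≠ 0 → IsZero (K.X n))
    (hK' : ∀ n : ℤ, n ≠ -1 → n ≠ 0 → IsZero (K'.X n))
    (h0 : ∀ e : Ext (K.X 0) (K'.X (-1)) 0, e = 0)
    (h1 : ∀ e : Ext (K.X 0) (K'.X (-1)) 1, e = 0) :
    Function.Bijective (fun f : K ⟶ K' => DerivedCategory.Q.map f) := by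
  have : K.IsStrictlyLE 0 := by
    rw [isStrictlyLE_iff]
    exact fun i hi ↦ hK i (by lia) (by lia)
  have : K.IsStrictlyGE (-1) := by
    rw [isStrictlyGE_iff]
    exact fun i hi ↦ hK i (by lia) (by lia)
  have : K'.IsStrictlyLE 0 := by
    rw [isStrictlyLE_iff]
    exact fun i hi ↦ hK' i (by lia) (by lia)
  have : K'.IsStrictlyGE (-1) := by
    rw [isStrictlyGE_iff]
    exact fun i hi ↦ hK' i (by lia) (by lia)
  refine ⟨fun f g hfg ↦ ?_, exists_Q_map_eq h1⟩
  rw [← sub_eq_zero]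
  refine eq_zero_of_Q_map_eq_zero (fun e ↦ ?_) _ ?_
  · exact (Ext.mk₀_eq_zero_iff e).1 (h0 _)
  · rw [Functor.map_sub, sub_eq_zero]
    exact hfg
end

section
/- Let B be an abelian group. The sequence Z[B\times B] \oplus Z[B\times B\times B] --d_01--> Z[B\times B] --d_00--> Z[B] is exact at Z[B\times B]: the kernel of d_00 equals the image of d_01. Equivalently, every element z of Z[B\times B] with d_00(z) = 0 is an integer linear combination of elements of the form [b1,b2] - [b2,b1] and [b1+b2,b3] - [b1,b2+b3] + [b1,b2] - [b2,b3]. -/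
open FreeAbelianGroup

/-- `d₀₀ : ℤ[B × B] →+ ℤ[B]`, `[b₁,b₂] ↦ [b₁+b₂] - [b₁] - [b₂]`. -/
noncomputable def d00 (B : Type*) [AddCommGroup B] :
    FreeAbelianGroup (B × B) →+ FreeAbelianGroup B :=
  FreeAbelianGroup.lift fun p => of (p.1 + p.2) - of p.1 - of p.2

/-- `d₀₁ : ℤ[B × B] ⊕ ℤ[B × B × B] →+ ℤ[B × B]`, given on the first summand by
`[b₁,b₂] ↦ [b₁,b₂] - [b₂,b₁]` and on the second summand by
`[b₁,b₂,b₃] ↦ [b₁+b₂,b₃] - [b₁,b₂+b₃] + [b₁,b₂] - [b₂,b₃]`. -/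
noncomputable def d01 (B : Type*) [AddCommGroup B] :
    FreeAbelianGroup (B × B) × FreeAbelianGroup (B × B × B) →+ FreeAbelianGroup (B × B) :=
  (FreeAbelianGroup.lift fun p : B × B => of p - of (p.2, p.1)).coprod
    (FreeAbelianGroup.lift fun t : B × B × B =>
      of (t.1 + t.2.1, t.2.2) - of (t.1, t.2.1 + t.2.2) + of (t.1, t.2.1) - of (t.2.1, t.2.2))

/-- A symmetric `2`-cocycle on the abelian group `B` with values in the abelian group `M`. -/
structure SymmCocycle (B M : Type*) [AddCommGroup B] [AddCommGroup M] where
  /-- The underlying function. -/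
  toFun : B → B → M
  symm' : ∀ a b, toFun a b = toFun b a
  cocycle' : ∀ a b c, toFun (a + b) c + toFun a b = toFun a (b + c) + toFun b c

namespace SymmCocycle

variable {B M : Type*} [AddCommGroup B] [AddCommGroup M]

lemma zero_left (f : SymmCocycle B M) (b : B) : f.toFun 0 b = f.toFun 0 0 := by
  simpa using (f.cocycle' 0 0 b).symm

lemma zero_right (f : SymmCocycle B M) (b : B) : f.toFun b 0 = f.toFun 0 0 := by
  rw [f.symm', f.zero_left]

/-- The extension of `B` by `M` classified by a symmetric `2`-cocycle. -/
@[ext]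
structure Extension (f : SymmCocycle B M) where
  /-- The component in the quotient. -/
  base : B
  /-- The component in the kernel. -/
  fiber : M

namespace Extension

variable {f : SymmCocycle B M}

instance : Add f.Extension :=
  ⟨fun x y => ⟨x.base + y.base, x.fiber + y.fiber + f.toFun x.base y.base⟩⟩

instance : Zero f.Extension := ⟨⟨0, -f.toFun 0 0⟩⟩

instance : Neg f.Extension :=
  ⟨fun x => ⟨-x.base, -x.fiber - f.toFun (-x.base) x.base - f.toFun 0 0⟩⟩

@[simp] lemma base_add (x y : f.Extension) : (x + y).base = x.base + y.base := rfl

@[simp] lemma fiber_add (x y : f.Extension) :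
    (x + y).fiber = x.fiber + y.fiber + f.toFun x.base y.base := rfl

@[simp] lemma base_zero : (0 : f.Extension).base = 0 := rfl

@[simp] lemma fiber_zero : (0 : f.Extension).fiber = -f.toFun 0 0 := rfl

@[simp] lemma base_neg (x : f.Extension) : (-x).base = -x.base := rfl

@[simp] lemma fiber_neg (x : f.Extension) :
    (-x).fiber = -x.fiber - f.toFun (-x.base) x.base - f.toFun 0 0 := rfl

instance : AddCommGroup f.Extension where
  add_assoc x y z := by
    ext
    · simp [add_assoc]
    · simp only [fiber_add, base_add]
      have h := congrArg (x.fiber + y.fiber + z.fiber + ·) (f.cocycle' x.base y.base z.base)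
      convert h using 1 <;> abel
  zero_add x := by
    ext
    · simp
    · simp [f.zero_left]
  add_zero x := by
    ext
    · simp
    · simp [f.zero_right]
  add_comm x y := by
    ext
    · simp [add_comm]
    · simp [f.symm' x.base y.base, add_comm x.fiber]
  neg_add_cancel x := by
    ext
    · simp
    · simp only [fiber_add, fiber_neg, base_neg, fiber_zero]
      abel
  nsmul := nsmulRec
  zsmul := zsmulRec

/-- The inclusion of the kernel into the extension. -/
def incl (f : SymmCocycle B M) : M →+ f.Extension where
  toFun m := ⟨0, m - f.toFun 0 0⟩
  map_zero' := by ext <;> simp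
  map_add' m n := by
    ext
    · simp
    · simp only [fiber_add]
      abel

lemma incl_injective (f : SymmCocycle B M) : Function.Injective (incl f) := fun m n h => by
  simpa [incl] using congrArg fiber h

/-- The cocycle is the failure of additivity of the section `b ↦ ⟨b, 0⟩`. -/
lemma incl_apply_cocycle (f : SymmCocycle B M) (a b : B) :
    incl f (f.toFun a b) = ⟨a, 0⟩ + ⟨b, 0⟩ - ⟨a + b, 0⟩ := by
  rw [eq_sub_iff_add_eq]
  ext
  · simp [incl]
  · simp [incl, f.zero_left]

end Extension

end SymmCocycle

lemma d00_comp_d01 (B : Type*) [AddCommGroup B] : (d00 B).comp (d01 B) = 0 := by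
  have hl : ((d00 B).comp (d01 B)).comp (AddMonoidHom.inl _ _) = 0 := by
    refine lift_ext _ _ fun p => ?_
    simp [d00, d01, add_comm, sub_right_comm]
  have hr : ((d00 B).comp (d01 B)).comp (AddMonoidHom.inr _ _) = 0 := by
    refine lift_ext _ _ fun t => ?_
    simp only [d00, d01, AddMonoidHom.comp_apply, AddMonoidHom.inr_apply,
      AddMonoidHom.coprod_apply, map_zero, zero_add, lift_apply_of, map_add, map_sub,
      AddMonoidHom.zero_apply, add_assoc]
    abel
  rw [← AddMonoidHom.coprod_unique ((d00 B).comp (d01 B)), hl, hr]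
  ext
  simp

/-- The universal symmetric `2`-cocycle on `B`, with values in the cokernel of `d₀₁`. -/
noncomputable def universalSymmCocycle (B : Type*) [AddCommGroup B] :
    SymmCocycle B (FreeAbelianGroup (B × B) ⧸ (d01 B).range) where
  toFun a b := QuotientAddGroup.mk' _ (of (a, b))
  symm' a b := by
    rw [← sub_eq_zero, ← map_sub, ← AddMonoidHom.mem_ker, QuotientAddGroup.ker_mk']
    exact ⟨(of (a, b), 0), by simp [d01]⟩
  cocycle' a b c := by
    rw [← sub_eq_zero, ← map_add, ← map_add, ← map_sub, ← AddMonoidHom.mem_ker,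
      QuotientAddGroup.ker_mk']
    refine ⟨(0, of (a, b, c)), ?_⟩
    simp only [d01, AddMonoidHom.coprod_apply, map_zero, zero_add, lift_apply_of]
    abel

/-- **Proposition 4.2, case `A = 0`, degree 1.** For an abelian group `B`, the sequence
`ℤ[B × B] ⊕ ℤ[B × B × B] --d₀₁--> ℤ[B × B] --d₀₀--> ℤ[B]` is exact at `ℤ[B × B]`:
the kernel of `d₀₀` equals the image of `d₀₁`. -/
theorem stmt5 (B : Type*) [AddCommGroup B] : (d01 B).range = (d00 B).ker := by
  apply le_antisymm
  · rintro _ ⟨x, rfl⟩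
    exact DFunLike.congr_fun (d00_comp_d01 B) x
  · intro z hz
    let f := universalSymmCocycle B
    let φ : FreeAbelianGroup B →+ f.Extension := lift fun b => -⟨b, 0⟩
    have key : φ.comp (d00 B) =
        (SymmCocycle.Extension.incl f).comp (QuotientAddGroup.mk' (d01 B).range) := by
      refine lift_ext _ _ fun p =>
        Eq.trans ?_ (SymmCocycle.Extension.incl_apply_cocycle f p.1 p.2).symm
      simp only [φ, d00, AddMonoidHom.comp_apply, lift_apply_of, map_sub]
      abel
    have hφ := DFunLike.congr_fun key z
    rw [AddMonoidHom.comp_apply, AddMonoidHom.mem_ker.mp hz, map_zero] at hφ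
    rw [← QuotientAddGroup.ker_mk' (d01 B).range, AddMonoidHom.mem_ker]
    apply SymmCocycle.Extension.incl_injective f
    rw [map_zero]
    exact hφ.symm
end

section
/- Let 0 -> B -> E --j--> L -> 0 be a short exact sequence in C, and let X denote the two-term chain complex [E --j--> L] with E in degree 0 and L in degree -1. Then X is isomorphic in the homotopy category K(C) to the complex consisting of B concentrated in degree 0 if and only if j admits a section s: L -> E with j \circ s = id_L (equivalently, if and only if the short exact sequence splits, i.e., E is isomorphic to B \oplus L compatibly with the given maps). -/
open CategoryTheory CategoryTheory.Limits

section TwoTerm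

variable {C : Type*} [Category C] [Abelian C] {S : ShortComplex C} {X : ChainComplex C ℤ}

/-- If a chain complex is homotopy equivalent to a complex concentrated in degree `0`, then the
identity in degree `-1` factors through the differential, provided degree `-2` vanishes. -/
lemma exists_comp_d_eq_id_of_homotopyEquiv_single {B : C}
    (h : HomotopyEquiv X ((HomologicalComplex.single C (ComplexShape.down ℤ) 0).obj B))
    (hX : IsZero (X.X (-2))) : ∃ t : X.X (-1) ⟶ X.X 0, t ≫ X.d 0 (-1) = 𝟙 _ := by
  have hc := h.homotopyHomInvId.comm (-1)
  rw [dNext_eq _ (show (ComplexShape.down ℤ).Rel (-1) (-2) by simp),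
    prevD_eq _ (show (ComplexShape.down ℤ).Rel 0 (-1) by simp),
    hX.eq_of_tgt (X.d (-1) (-2)) 0, HomologicalComplex.comp_f,
    (HomologicalComplex.isZero_single_obj_X (ComplexShape.down ℤ) 0 B (-1)
      (by simp)).eq_of_tgt (h.hom.f (-1)) 0] at hc
  refine ⟨-h.homotopyHomInvId.hom (-1) 0, ?_⟩
  rw [Preadditive.neg_comp, neg_eq_iff_add_eq_zero]
  simpa using hc.symm

/-- A two-term complex `[E ⟶ L]` attached to a split short exact sequence `0 ⟶ B ⟶ E ⟶ L ⟶ 0`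
is homotopy equivalent to `B` in degree `0`. -/
noncomputable def CategoryTheory.ShortComplex.Splitting.homotopyEquivSingle (σ : S.Splitting)
    (e0 : X.X 0 ≅ S.X₂) (e1 : X.X (-1) ≅ S.X₃)
    (hd : X.d 0 (-1) = e0.hom ≫ S.g ≫ e1.inv)
    (hX : ∀ n : ℤ, n ≠ 0 → n ≠ -1 → IsZero (X.X n)) :
    _root_.HomotopyEquiv X ((HomologicalComplex.single C (ComplexShape.down ℤ) 0).obj S.X₁) where
  hom := HomologicalComplex.mkHomToSingle (e0.hom ≫ σ.r) (fun i hi => by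
    obtain rfl : i = 1 := by simpa using hi.symm
    exact (hX 1 (by simp) (by simp)).eq_of_src _ _)
  inv := HomologicalComplex.mkHomFromSingle (S.f ≫ e0.inv) (fun i hi => by
    obtain rfl : i = -1 := by simp at hi; lia
    simp [hd])
  homotopyHomInvId :=
    { hom := fun i j =>
        if h : i = -1 ∧ j = 0 then
          -((X.XIsoOfEq h.1).hom ≫ e1.hom ≫ σ.s ≫ e0.inv ≫ (X.XIsoOfEq h.2).inv)
        else 0
      zero := fun i j hij => dif_neg (by
        rintro ⟨rfl, rfl⟩
        simp at hij)
      comm := fun n => by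
        by_cases h0 : n = 0
        · subst h0
          rw [dNext_eq _ (show (ComplexShape.down ℤ).Rel 0 (-1) by simp),
            prevD_eq _ (show (ComplexShape.down ℤ).Rel 1 0 by simp)]
          have hσ : S.g ≫ σ.s = 𝟙 _ - σ.r ≫ S.f := eq_sub_of_add_eq' σ.id
          simp [hd, reassoc_of% hσ]
        · by_cases h1 : n = -1
          · subst h1
            rw [dNext_eq _ (show (ComplexShape.down ℤ).Rel (-1) (-2) by simp),
              prevD_eq _ (show (ComplexShape.down ℤ).Rel 0 (-1) by simp), HomologicalComplex.comp_f,
              (HomologicalComplex.isZero_single_obj_X (ComplexShape.down ℤ) 0 S.X₁ (-1)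
                (by simp)).eq_of_tgt (HomologicalComplex.Hom.f _ (-1)) 0]
            simp [hd]
          · exact (hX n h0 h1).eq_of_src _ _ }
  homotopyInvHomId := _root_.Homotopy.ofEq (by
    apply HomologicalComplex.from_single_hom_ext
    simp)

end TwoTerm

/-- **A step in the proof of Theorem 3.2.** Let `0 → B → E --j--> L → 0` be a short exact
sequence in an abelian category `C` (encoded as a short exact short complex `S` with
`B = S.X₁`, `E = S.X₂`, `L = S.X₃`, `j = S.g`), and let `X` be the two-term chain complex
`[E --j--> L]` with `E` in degree `0` and `L` in degree `-1`. Then `X` is isomorphic in the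
homotopy category `K(C)` to the complex consisting of `B` concentrated in degree `0` if and
only if `j` admits a section `s : L ⟶ E` with `s ≫ j = 𝟙 L`. -/
theorem stmt8 {C : Type*} [Category C] [Abelian C]
    (S : ShortComplex C) (hS : S.ShortExact)
    (X : ChainComplex C ℤ)
    (e0 : X.X 0 ≅ S.X₂) (e1 : X.X (-1) ≅ S.X₃)
    (hd : X.d 0 (-1) = e0.hom ≫ S.g ≫ e1.inv)
    (hX : ∀ n : ℤ, n ≠ 0 → n ≠ -1 → IsZero (X.X n)) :
    Nonempty ((HomotopyCategory.quotient C (ComplexShape.down ℤ)).obj X ≅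
        (HomotopyCategory.quotient C (ComplexShape.down ℤ)).obj
          ((HomologicalComplex.single C (ComplexShape.down ℤ) 0).obj S.X₁)) ↔
      ∃ s : S.X₃ ⟶ S.X₂, s ≫ S.g = 𝟙 S.X₃ := by
  constructor
  · rintro ⟨i⟩
    obtain ⟨t, ht⟩ := exists_comp_d_eq_id_of_homotopyEquiv_single
      (HomotopyCategory.homotopyEquivOfIso i) (hX (-2) (by simp) (by simp))
    refine ⟨e1.inv ≫ t ≫ e0.hom, ?_⟩
    rw [hd] at ht
    rw [← cancel_mono e1.inv]
    simp [ht]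
  · rintro ⟨s, hs⟩
    have σ := ShortComplex.Splitting.ofExactOfSection S hS.exact s hs hS.mono_f
    exact ⟨HomotopyCategory.isoOfHomotopyEquiv
      (σ.homotopyEquivSingle e0 e1 hd hX)⟩
end
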